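/- arXiv:2104.05772 — 7 statements merged into one kernel-verified Lean document; each statement's English description precedes it below -/
import Mathlib

section
/- Let g, h : F(Σ) → F(Δ) be group homomorphisms between free groups, and suppose that neither g nor h is injective. Then the intersection ker(g) ∩ ker(h) of their kernels is non-trivial; that is, there exists x ∈ F(Σ) with x ≠ 1, g(x) = 1 and h(x) = 1. -/
namespace FreeGroup

/-- Distinct free generators do not commute. -/
theorem not_commute_of_of {X : Type*} {x y : X} (hxy : x ≠ y) :
    ¬ Commute (of x) (of y) := by
  classical
  intro h
  have h' := congrArg toWord h.eq
  simp [toWord_mul, toWord_of, reduce.cons, hxy, hxy.symm] at h'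

/-- A free group on at most one generator is cyclic. -/
theorem isCyclic_of_subsingleton {X : Type*} [Subsingleton X] : IsCyclic (FreeGroup X) := by
  rcases isEmpty_or_nonempty X with hX | ⟨⟨x⟩⟩
  · infer_instance
  · refine ⟨of x, fun w ↦ ?_⟩
    change w ∈ Subgroup.zpowers (of x)
    induction w using FreeGroup.induction_on with
    | C1 => exact one_mem _
    | of y => exact Subsingleton.elim x y ▸ Subgroup.mem_zpowers _
    | inv_of y ih => exact inv_mem ih
    | mul u v hu hv => exact mul_mem hu hv

/-- A commutative free group is cyclic. -/
theorem _root_.IsFreeGroup.isCyclic_of_commute {G : Type*} [Group G] [IsFreeGroup G]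
    (hG : ∀ a b : G, Commute a b) : IsCyclic G := by
  let e := IsFreeGroup.toFreeGroup G
  have : Subsingleton (IsFreeGroup.Generators G) := ⟨fun x y ↦ by
    by_contra hxy
    refine not_commute_of_of hxy ?_
    simpa using (hG (e.symm (of x)) (e.symm (of y))).map e⟩
  have := isCyclic_of_subsingleton (X := IsFreeGroup.Generators G)
  exact isCyclic_of_surjective e.symm e.symm.surjective

/-- Commuting elements of a free group are powers of a common element. -/
theorem exists_zpow_eq_of_commute {S : Type*} {a b : FreeGroup S} (hab : Commute a b) :
    ∃ (c : FreeGroup S) (m n : ℤ), c ^ m = a ∧ c ^ n = b := by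
  let H := Subgroup.closure {a, b}
  have hcomm : ∀ u v : H, Commute u v := by
    have := Subgroup.isMulCommutative_closure (k := {a, b}) (by
      rintro x (rfl | rfl) y (rfl | rfl)
      exacts [rfl, hab.eq, hab.eq.symm, rfl])
    exact fun u v ↦ mul_comm' u v
  obtain ⟨c, hc⟩ := (IsFreeGroup.isCyclic_of_commute hcomm).exists_generator
  obtain ⟨m, hm⟩ := hc ⟨a, Subgroup.subset_closure (by simp)⟩
  obtain ⟨n, hn⟩ := hc ⟨b, Subgroup.subset_closure (by simp)⟩
  exact ⟨c, m, n, by simpa using congrArg Subtype.val hm, by simpa using congrArg Subtype.val hn⟩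

end FreeGroup

/-- If `g, h : F(Σ) → F(Δ)` are both non-injective homomorphisms of free groups then
`ker g ∩ ker h` is non-trivial. -/
theorem nontrivial_inter_ker {S D : Type*} (g h : FreeGroup S →* FreeGroup D)
    (hg : ¬ Function.Injective g) (hh : ¬ Function.Injective h) :
    ∃ x : FreeGroup S, x ≠ 1 ∧ g x = 1 ∧ h x = 1 := by
  simp only [injective_iff_map_eq_one, not_forall] at hg hh
  obtain ⟨a, hga, ha⟩ := hg
  obtain ⟨b, hhb, hb⟩ := hh
  by_cases hab : Commute a b
  · obtain ⟨c, m, n, rfl, rfl⟩ := FreeGroup.exists_zpow_eq_of_commute hab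
    have hc : c ≠ 1 := by rintro rfl; simp at ha
    have hm : m ≠ 0 := by rintro rfl; simp at ha
    have hn : n ≠ 0 := by rintro rfl; simp at hb
    refine ⟨c ^ (m * n), ?_, by rw [zpow_mul, map_zpow, hga, one_zpow],
      by rw [mul_comm, zpow_mul, map_zpow, hhb, one_zpow]⟩
    simp [hc, hm, hn]
  · refine ⟨a * b * a⁻¹ * b⁻¹, fun h1 ↦ hab ?_, by simp [hga], by simp [hhb]⟩
    exact mul_inv_eq_iff_eq_mul.mp (mul_inv_eq_one.mp h1)
end

section
/- Let g, h : F(Σ) → F(Δ) be group homomorphisms between free groups, and suppose that neither g nor h is injective. Then the equaliser Eq(g, h) = {x ∈ F(Σ) : g(x) = h(x)} is non-trivial; that is, there exists x ∈ F(Σ) with x ≠ 1 and g(x) = h(x). -/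
namespace FreeGroup

/-- Distinct generators of a free group do not commute. -/
theorem eq_of_commute_of {X : Type*} {x y : X} (hxy : Commute (of x) (of y)) : x = y := by
  classical
  by_contra hne
  have key := congrArg (lift fun z =>
    if z = x then (Equiv.swap 0 1 : Equiv.Perm (Fin 3)) else Equiv.swap 1 2) hxy.eq
  simp only [_root_.map_mul, lift_apply_of, if_true, if_neg (Ne.symm hne)] at key
  exact absurd key (by decide)

end FreeGroup

/-- A free group in which all elements commute is cyclic. -/
theorem IsFreeGroup.isCyclic_of_commute_s1 {G : Type*} [Group G] [IsFreeGroup G]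
    (hG : ∀ a b : G, Commute a b) : IsCyclic G := by
  let e := IsFreeGroup.toFreeGroup G
  have : Subsingleton (IsFreeGroup.Generators G) := ⟨fun x y =>
    FreeGroup.eq_of_commute_of <| by
      simpa using (hG (e.symm (.of x)) (e.symm (.of y))).map e⟩
  rw [e.isCyclic]
  cases isEmpty_or_nonempty (IsFreeGroup.Generators G)
  · infer_instance
  · have := (nonempty_unique (IsFreeGroup.Generators G)).some
    infer_instance

/-- Commuting elements of a free group are powers of a common element. -/
theorem FreeGroup.exists_zpow_eq_of_commute_s1 {X : Type*} {a b : FreeGroup X} (hab : Commute a b) :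
    ∃ (c : FreeGroup X) (m n : ℤ), c ^ m = a ∧ c ^ n = b := by
  let H := Subgroup.closure {a, b}
  have hH : IsMulCommutative H := Subgroup.isMulCommutative_closure <| by
    rintro x (rfl | rfl) y (rfl | rfl)
    exacts [rfl, hab.eq, hab.eq.symm, rfl]
  have : IsCyclic H := IsFreeGroup.isCyclic_of_commute_s1 fun x y => hH.is_comm.comm x y
  obtain ⟨c, hc⟩ := IsCyclic.exists_generator (α := H)
  obtain ⟨m, hm⟩ := hc ⟨a, Subgroup.subset_closure (by simp)⟩
  obtain ⟨n, hn⟩ := hc ⟨b, Subgroup.subset_closure (by simp)⟩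
  exact ⟨c, m, n, congrArg Subtype.val hm, congrArg Subtype.val hn⟩

/-- Two non-trivial normal subgroups of a free group intersect non-trivially. -/
theorem FreeGroup.exists_ne_one_mem_inf {X : Type*} {M N : Subgroup (FreeGroup X)}
    [M.Normal] [N.Normal] (hM : M ≠ ⊥) (hN : N ≠ ⊥) : ∃ x ∈ M ⊓ N, x ≠ 1 := by
  obtain ⟨a, ha, ha1⟩ := M.bot_or_exists_ne_one.resolve_left hM
  obtain ⟨b, hb, hb1⟩ := N.bot_or_exists_ne_one.resolve_left hN
  by_contra! htriv
  have hab : Commute a b := Subgroup.commute_of_normal_of_disjoint M N ‹_› ‹_›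
    (disjoint_iff.mpr <| (Subgroup.eq_bot_iff_forall _).mpr htriv) a b ha hb
  obtain ⟨c, m, n, rfl, rfl⟩ := exists_zpow_eq_of_commute_s1 hab
  have hc : c ^ (m * n) = 1 := htriv _
    ⟨zpow_mul c m n ▸ M.zpow_mem ha n, zpow_mul' c m n ▸ N.zpow_mem hb m⟩
  rw [zpow_mul] at hc
  exact ha1 ((IsMulTorsionFree.zpow_eq_one_iff_left fun hn => hb1 (by simp [hn])).mp hc)

/-- If `g, h : F(Σ) → F(Δ)` are both non-injective homomorphisms of free groups then
their equaliser is non-trivial. -/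
theorem nontrivial_equaliser {S D : Type*} (g h : FreeGroup S →* FreeGroup D)
    (hg : ¬ Function.Injective g) (hh : ¬ Function.Injective h) :
    ∃ x : FreeGroup S, x ≠ 1 ∧ g x = h x := by
  rw [← MonoidHom.ker_eq_bot_iff] at hg hh
  obtain ⟨x, ⟨hxg, hxh⟩, hx⟩ := FreeGroup.exists_ne_one_mem_inf hg hh
  exact ⟨x, hx, hxg.trans hxh.symm⟩
end

section
/- The map g' is injective if and only if g is injective, and the map h' is injective if and only if h is injective. -/
namespace PCP

/-- The extended source alphabet `Σ' = Σ ⊔ {B, E}`: `Sum.inr false` is `B`, `Sum.inr true` is `E`. -/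
abbrev Sig' (S : Type*) := S ⊕ Bool

/-- The extended target alphabet `Δ' = Δ ⊔ {B, E, #}`:
`Sum.inr 0` is `B`, `Sum.inr 1` is `E`, `Sum.inr 2` is `#`. -/
abbrev Del' (D : Type*) := D ⊕ Fin 3

/-- The generator `B` of `F(Σ')`. -/
def Bs {S : Type*} : FreeGroup (Sig' S) := FreeGroup.of (Sum.inr false)

/-- The generator `E` of `F(Σ')`. -/
def Es {S : Type*} : FreeGroup (Sig' S) := FreeGroup.of (Sum.inr true)

/-- The generator `B` of `F(Δ')`. -/
def Bd {D : Type*} : FreeGroup (Del' D) := FreeGroup.of (Sum.inr 0)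

/-- The generator `E` of `F(Δ')`. -/
def Ed {D : Type*} : FreeGroup (Del' D) := FreeGroup.of (Sum.inr 1)

/-- The generator `#` of `F(Δ')`. -/
def hsh {D : Type*} : FreeGroup (Del' D) := FreeGroup.of (Sum.inr 2)

/-- The inclusion `ιΣ : F(Σ) → F(Σ')`. -/
def incS {S : Type*} : FreeGroup S →* FreeGroup (Sig' S) := FreeGroup.map Sum.inl

/-- The inclusion `ι : F(Δ) → F(Δ')`. -/
def incD {D : Type*} : FreeGroup D →* FreeGroup (Del' D) := FreeGroup.map Sum.inl

/-- The homomorphism `g' : F(Σ') → F(Δ')` associated to `g, u₁, u₂`. -/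
def gMap {S D : Type*} (g : FreeGroup S →* FreeGroup D) (u₁ u₂ : FreeGroup D) :
    FreeGroup (Sig' S) →* FreeGroup (Del' D) :=
  FreeGroup.lift fun z => match z with
    | Sum.inl s => hsh⁻¹ * incD (g (FreeGroup.of s)) * hsh
    | Sum.inr false => Bd * hsh * incD u₁ * hsh
    | Sum.inr true => hsh⁻¹ * incD u₂ * hsh * Ed

/-- The homomorphism `h' : F(Σ') → F(Δ')` associated to `h, v₁, v₂`. -/
def hMap {S D : Type*} (h : FreeGroup S →* FreeGroup D) (v₁ v₂ : FreeGroup D) :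
    FreeGroup (Sig' S) →* FreeGroup (Del' D) :=
  FreeGroup.lift fun z => match z with
    | Sum.inl s => hsh * incD (h (FreeGroup.of s)) * hsh⁻¹
    | Sum.inr false => Bd * hsh * incD v₁ * hsh⁻¹
    | Sum.inr true => hsh * incD v₂ * hsh * Ed

end PCP


namespace Monoid.CoprodI

variable {ι : Type*} {M N : ι → Type*} [∀ i, Monoid (M i)] [∀ i, Monoid (N i)]

/-- The image of a reduced word under a family of injective homomorphisms. -/
def Word.mapInjective (f : ∀ i, M i →* N i) (hf : ∀ i, Function.Injective (f i)) (w : Word M) :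
    Word N where
  toList := w.toList.map fun x => ⟨x.1, f x.1 x.2⟩
  ne_one := by
    intro l hl
    obtain ⟨x, hx, rfl⟩ := List.mem_map.1 hl
    exact fun h => w.ne_one x hx ((map_eq_one_iff _ (hf x.1)).1 h)
  chain_ne := by
    rw [List.isChain_map]
    exact w.chain_ne

theorem Word.prod_mapInjective (f : ∀ i, M i →* N i) (hf : ∀ i, Function.Injective (f i))
    (w : Word M) : (w.mapInjective f hf).prod = lift (fun i => of.comp (f i)) w.prod := by
  simp [Word.prod, Word.mapInjective, map_list_prod, Function.comp_def]

theorem Word.mapInjective_injective (f : ∀ i, M i →* N i) (hf : ∀ i, Function.Injective (f i)) :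
    Function.Injective (Word.mapInjective f hf) := by
  intro v w h
  refine Word.ext (List.map_injective_iff.2 ?_ (congrArg Word.toList h))
  rintro ⟨i, x⟩ ⟨j, y⟩ hxy
  obtain ⟨rfl, hxy⟩ := Sigma.mk.inj_iff.1 hxy
  exact congrArg (Sigma.mk i) (hf i (eq_of_heq hxy))

/-- A free product of injective homomorphisms is injective. -/
theorem lift_of_comp_injective (f : ∀ i, M i →* N i) (hf : ∀ i, Function.Injective (f i)) :
    Function.Injective (lift fun i => (of : N i →* CoprodI N).comp (f i)) := by
  classical
  intro x y h
  obtain ⟨v, rfl⟩ := (Word.equiv (M := M)).symm.surjective x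
  obtain ⟨w, rfl⟩ := (Word.equiv (M := M)).symm.surjective y
  change lift _ v.prod = lift _ w.prod at h
  rw [← Word.prod_mapInjective f hf, ← Word.prod_mapInjective f hf] at h
  rw [Word.mapInjective_injective f hf (Word.equiv.symm.injective h)]

end Monoid.CoprodI

namespace FreeGroup

/-- Extending an injective homomorphism of free groups by an injective map on additional
generators gives an injective homomorphism. -/
theorem lift_sumElim_injective.{u, v, w, x} {A : Type u} {B : Type v} {C : Type w} {E : Type x}
    (f : FreeGroup A →* FreeGroup B)
    (hf : Function.Injective f) (j : C → E) (hj : Function.Injective j) :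
    Function.Injective (lift (Sum.elim (fun a => map Sum.inl (f (of a)))
      (fun c => of (Sum.inr (j c)))) : FreeGroup (A ⊕ C) →* FreeGroup (B ⊕ E)) := by
  let X : Bool → Type (max u w) := fun b => cond b (ULift A) (ULift C)
  let Y : Bool → Type (max v x) := fun b => cond b (ULift B) (ULift E)
  let F : ∀ b, FreeGroup (X b) →* FreeGroup (Y b) := fun b => match b with
    | true => (map ULift.up).comp (f.comp (map ULift.down))
    | false => map (ULift.map j)
  have hF : ∀ b, Function.Injective (F b) := by
    rintro (_ | _)
    · exact map_injective (ULift.map_injective.2 hj)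
    · exact (map_injective ULift.up_injective).comp (hf.comp (map_injective ULift.down_injective))
  let θ : FreeGroup (A ⊕ C) →* Monoid.CoprodI fun b => FreeGroup (X b) :=
    lift (Sum.elim (fun a => Monoid.CoprodI.of (i := true) (of (ULift.up a)))
      (fun c => Monoid.CoprodI.of (i := false) (of (ULift.up c))))
  let θ' : (Monoid.CoprodI fun b => FreeGroup (X b)) →* FreeGroup (A ⊕ C) :=
    Monoid.CoprodI.lift fun b => match b with
      | true => map fun a => Sum.inl a.down
      | false => map fun c => Sum.inr c.down
  let ψ : FreeGroup (B ⊕ E) →* Monoid.CoprodI fun b => FreeGroup (Y b) :=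
    lift (Sum.elim (fun a => Monoid.CoprodI.of (i := true) (of (ULift.up a)))
      (fun c => Monoid.CoprodI.of (i := false) (of (ULift.up c))))
  have hθ : Function.LeftInverse θ' θ := by
    refine DFunLike.congr_fun (?_ : θ'.comp θ = MonoidHom.id _)
    ext (a | c)
    · simp only [θ, θ', MonoidHom.comp_apply, lift_apply_of, Sum.elim_inl,
        Monoid.CoprodI.lift_of]
      exact map.of
    · simp only [θ, θ', MonoidHom.comp_apply, lift_apply_of, Sum.elim_inr,
        Monoid.CoprodI.lift_of]
      exact map.of
  have hψ : ψ.comp (map Sum.inl) =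
      (Monoid.CoprodI.of (M := fun b => FreeGroup (Y b)) (i := true)).comp (map ULift.up) := by
    ext b
    simp only [MonoidHom.comp_apply, map.of, ψ, lift_apply_of, Sum.elim_inl]
  have key : ψ.comp (lift (Sum.elim (fun a => map Sum.inl (f (of a)))
      (fun c => of (Sum.inr (j c))))) =
      (Monoid.CoprodI.lift fun b =>
        (Monoid.CoprodI.of (M := fun b => FreeGroup (Y b))).comp (F b)).comp θ := by
    ext (a | c)
    · simp only [θ, MonoidHom.comp_apply, lift_apply_of, Sum.elim_inl, Monoid.CoprodI.lift_of]
      exact DFunLike.congr_fun hψ (f (of a))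
    · simp only [θ, ψ, MonoidHom.comp_apply, lift_apply_of, Sum.elim_inr, Monoid.CoprodI.lift_of]
      rfl
  refine Function.Injective.of_comp (f := ψ) ?_
  rw [← MonoidHom.coe_comp, key, MonoidHom.coe_comp]
  exact (Monoid.CoprodI.lift_of_comp_injective F hF).comp hθ.injective

end FreeGroup

namespace PCP

variable {S D : Type*}

/-- The endomorphism of `F(Δ')` erasing `#` that sends `B` to `B·a` and `E` to `b·E`. -/
def eraseHash (a b : FreeGroup D) : FreeGroup (Del' D) →* FreeGroup (Del' D) :=
  FreeGroup.lift (Sum.elim (fun d => FreeGroup.of (Sum.inl d))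
    ![Bd * incD a, incD b * Ed, 1])

theorem eraseHash_incD (a b x : FreeGroup D) : eraseHash a b (incD x) = incD x := by
  have : (eraseHash a b).comp incD = incD := by
    ext d
    simp [eraseHash, incD]
  exact DFunLike.congr_fun this x

@[simp]
theorem eraseHash_hsh (a b : FreeGroup D) : eraseHash a b hsh = 1 := by
  simp [eraseHash, hsh]

@[simp]
theorem eraseHash_Bd (a b : FreeGroup D) : eraseHash a b Bd = Bd * incD a := by
  simp [eraseHash, Bd]

@[simp]
theorem eraseHash_Ed (a b : FreeGroup D) : eraseHash a b Ed = incD b * Ed := by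
  simp [eraseHash, Ed]

theorem incS_injective : Function.Injective (incS : FreeGroup S →* _) :=
  FreeGroup.map_injective Sum.inl_injective

theorem incD_injective : Function.Injective (incD : FreeGroup D →* _) :=
  FreeGroup.map_injective Sum.inl_injective

/-- If `φ` acts on the image of `F(Σ)` as a conjugate of `f`, and erasing `#` turns `φ` into the
extension of `f` fixing `B` and `E`, then `φ` is injective iff `f` is. -/
theorem injective_iff_of_eraseHash (f : FreeGroup S →* FreeGroup D)
    (φ : FreeGroup (Sig' S) →* FreeGroup (Del' D)) (c : FreeGroup (Del' D)) (a b : FreeGroup D)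
    (hφ : ∀ s, φ (FreeGroup.of (Sum.inl s)) = c * incD (f (FreeGroup.of s)) * c⁻¹)
    (hc : eraseHash a b c = 1) (hB : eraseHash a b (φ Bs) = Bd) (hE : eraseHash a b (φ Es) = Ed) :
    Function.Injective φ ↔ Function.Injective f := by
  constructor
  · intro h
    have hcomp : φ.comp incS = (MulAut.conj c).toMonoidHom.comp (incD.comp f) := by
      ext s
      simp [incS, hφ]
    have hinj : Function.Injective (φ.comp incS) := h.comp incS_injective
    rw [hcomp, MonoidHom.coe_comp, MonoidHom.coe_comp] at hinj
    exact hinj.of_comp.of_comp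
  · intro h
    have hj : Function.Injective (fun b : Bool => cond b (1 : Fin 3) 0) := by decide
    have hcomp : (eraseHash a b).comp φ = FreeGroup.lift
        (Sum.elim (fun s => FreeGroup.map Sum.inl (f (FreeGroup.of s)))
          (fun b => FreeGroup.of (Sum.inr (cond b (1 : Fin 3) 0)))) := by
      ext (s | _ | _)
      · simp [hφ, hc, eraseHash_incD]
        rfl
      · simpa [Bs, Bd] using hB
      · simpa [Es, Ed] using hE
    refine Function.Injective.of_comp (f := eraseHash a b) ?_
    rw [← MonoidHom.coe_comp, hcomp]
    exact FreeGroup.lift_sumElim_injective f h _ hj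

end PCP

open PCP in
/-- `g'` is injective iff `g` is, and `h'` is injective iff `h` is. -/
theorem injective_iff_injective {S D : Type*} (g h : FreeGroup S →* FreeGroup D)
    (u₁ u₂ v₁ v₂ : FreeGroup D) :
    (Function.Injective (gMap g u₁ u₂) ↔ Function.Injective g) ∧
    (Function.Injective (hMap h v₁ v₂) ↔ Function.Injective h) := by
  constructor
  · exact injective_iff_of_eraseHash g _ hsh⁻¹ u₁⁻¹ u₂⁻¹ (by simp [gMap]) (by simp)
      (by simp [gMap, Bs, eraseHash_incD]) (by simp [gMap, Es, eraseHash_incD])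
  · exact injective_iff_of_eraseHash h _ hsh v₁⁻¹ v₂⁻¹ (by simp [hMap]) (by simp)
      (by simp [hMap, Bs, eraseHash_incD]) (by simp [hMap, Es, eraseHash_incD])
end

section
/- Suppose at least one of g, h is injective. Then every element w of the equaliser Eq(g', h') = {w ∈ F(Σ') : g'(w) = h'(w)} can be written as a finite product w = s₁·s₂·⋯·s_n where each factor s_i lies in Eq(g', h') and each s_i has one of the following forms for some x ∈ F(Σ): B·ιΣ(x)·E, (B·ιΣ(x)·E)⁻¹, E⁻¹·ιΣ(x)·E, or B·ιΣ(x)·B⁻¹. -/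
namespace PCP

/-- Formal alternating products `a₀ y₁^±1 a₁ ⋯ yₙ^±1 aₙ` with coefficients in `A` and letters `yᵢ`
from a two-letter alphabet; the second boolean is the sign of the exponent. -/
inductive AltWord (A : Type*) where
  | nil (a : A) : AltWord A
  | cons (a : A) (y e : Bool) (t : AltWord A) : AltWord A

/-- The element `y` or its inverse, according to a sign. -/
def signed {G : Type*} [Group G] (y : G) (e : Bool) : G := if e then y else y⁻¹

namespace AltWord

variable {A : Type*} [Group A]

/-- The number of letters. -/
def size {A : Type*} : AltWord A → ℕ
  | nil _ => 0
  | cons _ _ _ t => t.size + 1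

/-- No subword `y^±1 · 1 · y^∓1` occurs. -/
def Red : AltWord A → Prop
  | nil _ => True
  | cons _ y e t => t.Red ∧ ∀ t', t ≠ cons 1 y (!e) t'

/-- Multiplication on the left by a coefficient. -/
def mulHead (c : A) : AltWord A → AltWord A
  | nil a => nil (c * a)
  | cons a y e t => cons (c * a) y e t

open Classical in
/-- Multiplication on the left by a signed letter, with cancellation. -/
noncomputable def push (y e : Bool) : AltWord A → AltWord A
  | nil a => cons 1 y e (nil a)
  | cons a y' e' t =>
    if a = 1 ∧ y' = y ∧ e' = !e then t else cons 1 y e (cons a y' e' t)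

theorem Red.mulHead {s : AltWord A} (hs : s.Red) (c : A) : (s.mulHead c).Red := by
  cases s <;> exact hs

theorem Red.push {s : AltWord A} (hs : s.Red) (y e : Bool) : (s.push y e).Red := by
  cases s with
  | nil a => simp [AltWord.push, Red]
  | cons a y' e' t =>
    rw [AltWord.push]
    split_ifs with hc
    · exact hs.1
    · refine ⟨hs, fun t' ht => hc ?_⟩
      cases ht
      simp

theorem push_push_not {s : AltWord A} (hs : s.Red) (y e : Bool) :
    (s.push y (!e)).push y e = s := by
  cases s with
  | nil a => simp [push]
  | cons a y' e' t =>
    by_cases hc : a = 1 ∧ y' = y ∧ e' = e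
    · obtain ⟨rfl, rfl, rfl⟩ := hc
      cases t with
      | nil b => simp [push]
      | cons b y'' e'' t' =>
        have hb : ¬(b = 1 ∧ y'' = y' ∧ e'' = !e') := by
          rintro ⟨rfl, rfl, rfl⟩
          exact hs.2 t' rfl
        simp [push, hb]
    · simp [push, hc]

theorem size_mulHead (c : A) (s : AltWord A) : (s.mulHead c).size = s.size := by
  cases s <;> rfl

theorem size_push_le (y e : Bool) (s : AltWord A) : (s.push y e).size ≤ s.size + 1 := by
  cases s with
  | nil a => simp [push, size]
  | cons a y' e' t =>
    rw [push]
    split_ifs <;> simp [size]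
    omega

theorem size_push_lt_or (y e : Bool) (s : AltWord A) :
    (s.push y e).size < s.size + 1 ∨ s.push y e = cons 1 y e s := by
  cases s with
  | nil a => simp [push]
  | cons a y' e' t =>
    rw [push]
    split_ifs
    · left
      simp only [size]
      omega
    · simp

theorem push_eq_cons {y e : Bool} {s : AltWord A} (hs : ∀ t', s ≠ cons 1 y (!e) t') :
    s.push y e = cons 1 y e s := by
  cases s with
  | nil a => rfl
  | cons a y' e' t =>
    rw [AltWord.push, if_neg]
    rintro ⟨rfl, rfl, rfl⟩
    exact hs t rfl

/-- Reduced alternating words. -/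
abbrev Normal (A : Type*) [Group A] := {s : AltWord A // s.Red}

/-- Coefficients act on reduced words by left multiplication. -/
def coeffPerm : A →* Equiv.Perm (Normal A) :=
  MonoidHom.toHomPerm
    { toFun := fun c s => ⟨s.1.mulHead c, s.2.mulHead c⟩
      map_one' := by
        funext s
        apply Subtype.ext
        rcases s with ⟨_ | _, _⟩ <;> simp [mulHead, Function.End.one_def]
      map_mul' := fun c d => by
        funext s
        apply Subtype.ext
        change s.1.mulHead (c * d) = (s.1.mulHead d).mulHead c
        cases s.1 <;> simp [mulHead, mul_assoc] }

/-- Letters act on reduced words by left multiplication. -/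
noncomputable def letterPerm (y : Bool) : Equiv.Perm (Normal A) where
  toFun s := ⟨s.1.push y true, s.2.push y true⟩
  invFun s := ⟨s.1.push y false, s.2.push y false⟩
  left_inv s := Subtype.ext (push_push_not s.2 y false)
  right_inv s := Subtype.ext (push_push_not s.2 y true)

theorem coeffPerm_apply (c : A) (s : Normal A) : (coeffPerm c s).1 = s.1.mulHead c := rfl

theorem signed_letterPerm_apply (y e : Bool) (s : Normal A) :
    (signed (letterPerm y) e s).1 = s.1.push y e := by
  cases e <;> rfl

/-- The value of an alternating word in a group. -/
def eval {G : Type*} [Group G] (f : A → G) (y : Bool → G) : AltWord A → G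
  | nil a => f a
  | cons a b e t => f a * (signed (y b) e * eval f y t)

theorem eval_mulHead {G : Type*} [Group G] (f : A →* G) (y : Bool → G) (c : A) (s : AltWord A) :
    (s.mulHead c).eval f y = f c * s.eval f y := by
  cases s <;> simp [mulHead, eval, mul_assoc]

theorem eval_push {G : Type*} [Group G] (f : A →* G) (y : Bool → G) (b e : Bool)
    (s : AltWord A) : (s.push b e).eval f y = signed (y b) e * s.eval f y := by
  cases s with
  | nil a => simp [push, eval]
  | cons a y' e' t =>
    rw [push]
    split_ifs with hc
    · obtain ⟨rfl, rfl, rfl⟩ := hc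
      cases e <;> simp [eval, signed]
    · simp [eval]

/-- The empty reduced word. -/
def base : Normal A := ⟨nil 1, trivial⟩

/-- Acting by an alternating word on the empty word either recovers the word or
produces a strictly shorter one. -/
theorem size_eval_lt_or (s : AltWord A) :
    ((s.eval coeffPerm letterPerm) base).1.size < s.size ∨
      ((s.eval coeffPerm letterPerm) base).1 = s := by
  induction s with
  | nil a => simp [eval, coeffPerm_apply, base, mulHead]
  | cons a y e t ih =>
    simp only [eval, Equiv.Perm.mul_apply, coeffPerm_apply, signed_letterPerm_apply, size_mulHead]
    rcases ih with ih | ih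
    · left
      have := size_push_le y e (t.eval coeffPerm letterPerm base).1
      simp only [size]
      omega
    · rw [ih]
      rcases size_push_lt_or y e t with h | h
      · exact Or.inl h
      · right
        simp [h, mulHead]

theorem Red.eval_base {s : AltWord A} (hs : s.Red) :
    ((s.eval coeffPerm letterPerm) base).1 = s := by
  induction s with
  | nil a => simp [eval, coeffPerm_apply, base, AltWord.mulHead]
  | cons a y e t ih =>
    simp only [eval, Equiv.Perm.mul_apply, coeffPerm_apply, signed_letterPerm_apply, ih hs.1,
      push_eq_cons hs.2, AltWord.mulHead, mul_one]

/-- The word obtained by applying `φ` to the coefficients, replacing each letter `y` by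
`(L y false)⁻¹ · y · L y true`, and multiplying on the left by `c`. -/
def subst {A' : Type*} [Group A'] (φ : A → A') (L : Bool → Bool → A') :
    A' → AltWord A → AltWord A'
  | c, nil a => nil (c * φ a)
  | c, cons a y e t => cons (c * φ a * (L y (!e))⁻¹) y e (subst φ L (L y e) t)

theorem size_subst {A A' : Type*} [Group A'] (φ : A → A') (L : Bool → Bool → A') (c : A')
    (s : AltWord A) : (s.subst φ L c).size = s.size := by
  induction s generalizing c with
  | nil a => rfl
  | cons a y e t ih => simp [subst, size, ih]

theorem Red.subst {A' : Type*} [Group A'] {φ : A →* A'} (hφ : Function.Injective φ)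
    (L : Bool → Bool → A') (c : A') {s : AltWord A} (hs : s.Red) : (s.subst φ L c).Red := by
  induction s generalizing c with
  | nil a => trivial
  | cons a y e t ih =>
    refine ⟨ih _ hs.1, fun t' ht => ?_⟩
    cases t with
    | nil b => cases ht
    | cons b y' e' t =>
      simp only [AltWord.subst, cons.injEq] at ht
      obtain ⟨hb, rfl, rfl, -⟩ := ht
      have hb' : φ b = 1 := by simpa using hb
      obtain rfl := (map_eq_one_iff φ hφ).1 hb'
      exact hs.2 t rfl

theorem eval_subst {A' G H : Type*} [Group A'] [Group G] [Group H] (f : A →* G) (y : Bool → G)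
    (f' : A' →* H) (y' : Bool → H) (F : G →* H) (φ : A → A') (L : Bool → Bool → A')
    (hf : ∀ a, F (f a) = f' (φ a))
    (hy : ∀ b, F (y b) = (f' (L b false))⁻¹ * y' b * f' (L b true)) (c : A') (s : AltWord A) :
    (s.subst φ L c).eval f' y' = f' c * F (s.eval f y) := by
  induction s generalizing c with
  | nil a => simp [AltWord.subst, eval, hf]
  | cons a b e t ih => cases e <;> simp [AltWord.subst, eval, ih, hf, hy, signed, mul_assoc]

/-- If one of two substitutions is injective on coefficients and both agree on a reduced word after
evaluation in the permutation group, then they agree formally. -/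
theorem Red.subst_eq {A' : Type*} [Group A'] {φ : A →* A'} (hφ : Function.Injective φ) (ψ : A → A')
    (L M : Bool → Bool → A') (c d : A') {s : AltWord A} (hs : s.Red)
    (h : (s.subst φ L c).eval coeffPerm letterPerm = (s.subst ψ M d).eval coeffPerm letterPerm) :
    s.subst φ L c = s.subst ψ M d := by
  have h1 := (hs.subst hφ L c).eval_base
  rw [h] at h1
  rcases size_eval_lt_or (s.subst ψ M d) with h2 | h2
  · rw [h1, size_subst, size_subst] at h2
    exact absurd h2 (lt_irrefl _)
  · exact h1.symm.trans h2

/-- Every element of `F(Σ')` is the value of a reduced word. -/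
theorem exists_red_eval {S : Type*} (w : FreeGroup (Sig' S)) :
    ∃ s : AltWord (FreeGroup S), s.Red ∧
      s.eval incS (fun b => FreeGroup.of (Sum.inr b)) = w := by
  let ρ : FreeGroup (Sig' S) →* Equiv.Perm (Normal (FreeGroup S)) :=
    FreeGroup.lift (Sum.elim (fun z => coeffPerm (FreeGroup.of z)) letterPerm)
  let ev : Normal (FreeGroup S) → FreeGroup (Sig' S) :=
    fun n => n.1.eval incS (fun b => FreeGroup.of (Sum.inr b))
  have key : ∀ w n, ev (ρ w n) = w * ev n := by
    intro w
    induction w using FreeGroup.induction_on with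
    | C1 => simp
    | of z =>
      intro n
      rcases z with z | b
      · simp only [ρ, ev, FreeGroup.lift_apply_of, Sum.elim_inl, coeffPerm_apply, eval_mulHead]
        simp [incS]
      · simp only [ρ, ev, FreeGroup.lift_apply_of, Sum.elim_inr]
        exact (eval_push incS _ b true n.1)
    | inv_of z ih =>
      intro n
      have := ih (ρ (FreeGroup.of z)⁻¹ n)
      rw [← Equiv.Perm.mul_apply, ← map_mul, mul_inv_cancel, map_one, Equiv.Perm.one_apply] at this
      rw [this, inv_mul_cancel_left]
    | mul x y hx hy =>
      intro n
      rw [map_mul, Equiv.Perm.mul_apply, hx, hy, mul_assoc]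
  refine ⟨(ρ w base).1, (ρ w base).2, (key w base).trans ?_⟩
  simp [ev, base, eval]

end AltWord

/-- The shift of `ℤ × F`, the image of `#` in a permutation representation. -/
def shift (F : Type*) : Equiv.Perm (ℤ × F) :=
  (Equiv.addRight (1 : ℤ)).prodCongr (Equiv.refl F)

theorem shift_apply {F : Type*} (n : ℤ) (x : F) : shift F (n, x) = (n + 1, x) := rfl

theorem shift_symm_apply {F : Type*} (n : ℤ) (x : F) : (shift F).symm (n, x) = (n - 1, x) := rfl

/-- `F` acts on `ℤ × F` by left multiplication on the fibre over `0`. -/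
def fibreMul (F : Type*) [Group F] : F →* Equiv.Perm (ℤ × F) :=
  MonoidHom.toHomPerm
    { toFun := fun p x => (x.1, if x.1 = 0 then p * x.2 else x.2)
      map_one' := by
        funext x
        simp [Function.End.one_def]
      map_mul' := fun p q => by
        funext x
        change _ = (x.1, if x.1 = 0 then p * (if x.1 = 0 then q * x.2 else x.2)
          else if x.1 = 0 then q * x.2 else x.2)
        by_cases hx : x.1 = 0 <;> simp [hx, mul_assoc] }

section

variable {F : Type*} [Group F]

theorem fibreMul_apply (p : F) (n : ℤ) (x : F) :
    fibreMul F p (n, x) = (n, if n = 0 then p * x else x) := rfl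

theorem fibreMul_symm_apply (p : F) (n : ℤ) (x : F) :
    (fibreMul F p).symm (n, x) = (n, if n = 0 then p⁻¹ * x else x) := by
  rw [← Equiv.Perm.inv_def, ← map_inv, fibreMul_apply]

theorem fibreMul_injective : Function.Injective (fibreMul F) := by
  intro p q hpq
  simpa [fibreMul_apply] using congrArg (fun f => f ((0 : ℤ), (1 : F))) hpq

/-- The homomorphism `p ↦ #⁻¹ p #`, in the permutation representation. -/
def conjLeft (F : Type*) [Group F] : F →* Equiv.Perm (ℤ × F) :=
  (MulAut.conj (shift F)⁻¹).toMonoidHom.comp (fibreMul F)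

/-- The homomorphism `p ↦ # p #⁻¹`, in the permutation representation. -/
def conjRight (F : Type*) [Group F] : F →* Equiv.Perm (ℤ × F) :=
  (MulAut.conj (shift F)).toMonoidHom.comp (fibreMul F)

theorem conjLeft_apply (p : F) : conjLeft F p = (shift F)⁻¹ * fibreMul F p * shift F := by
  simp [conjLeft]

theorem conjRight_apply (p : F) : conjRight F p = shift F * fibreMul F p * (shift F)⁻¹ := by
  simp [conjRight]

theorem conjLeft_injective : Function.Injective (conjLeft F) :=
  (MulAut.conj (shift F)⁻¹).injective.comp fibreMul_injective

theorem conjRight_injective : Function.Injective (conjRight F) :=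
  (MulAut.conj (shift F)).injective.comp fibreMul_injective

theorem eq_one_of_conjLeft_eq_conjRight {p q : F} (hpq : conjLeft F p = conjRight F q) :
    p = 1 ∧ q = 1 := by
  rw [conjLeft_apply, conjRight_apply] at hpq
  constructor
  · simpa [fibreMul_apply, shift_apply, shift_symm_apply] using
      congrArg (fun f => (f ((-1 : ℤ), (1 : F))).2) hpq
  · simpa [fibreMul_apply, shift_apply, shift_symm_apply, eq_comm] using
      congrArg (fun f => (f ((1 : ℤ), (1 : F))).2) hpq

/-- The coefficients following the letters `B^±1`, `E^±1` in their images under `g'`. -/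
def gCoeff (u₁ u₂ : F) : Bool → Bool → Equiv.Perm (ℤ × F)
  | false, true => shift F * fibreMul F u₁ * shift F
  | false, false => 1
  | true, true => 1
  | true, false => ((shift F)⁻¹ * fibreMul F u₂ * shift F)⁻¹

/-- The coefficients following the letters `B^±1`, `E^±1` in their images under `h'`. -/
def hCoeff (v₁ v₂ : F) : Bool → Bool → Equiv.Perm (ℤ × F)
  | false, true => shift F * fibreMul F v₁ * (shift F)⁻¹
  | false, false => 1
  | true, true => 1
  | true, false => (shift F * fibreMul F v₂ * shift F)⁻¹

end

section

variable {S D : Type*} (g h : FreeGroup S →* FreeGroup D) (u₁ u₂ v₁ v₂ : FreeGroup D)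

theorem gMap_incS (x : FreeGroup S) :
    gMap g u₁ u₂ (incS x) = hsh⁻¹ * incD (g x) * hsh := by
  have : (gMap g u₁ u₂).comp incS =
      (MulAut.conj (hsh : FreeGroup (Del' D))⁻¹).toMonoidHom.comp (incD.comp g) := by
    ext z
    simp [gMap, incS]
  simpa using DFunLike.congr_fun this x

theorem hMap_incS (x : FreeGroup S) :
    hMap h v₁ v₂ (incS x) = hsh * incD (h x) * hsh⁻¹ := by
  have : (hMap h v₁ v₂).comp incS =
      (MulAut.conj (hsh : FreeGroup (Del' D))).toMonoidHom.comp (incD.comp h) := by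
    ext z
    simp [hMap, incS]
  simpa using DFunLike.congr_fun this x

theorem gMap_Bs : gMap g u₁ u₂ Bs = Bd * hsh * incD u₁ * hsh := by simp [gMap, Bs]

theorem gMap_Es : gMap g u₁ u₂ Es = hsh⁻¹ * incD u₂ * hsh * Ed := by simp [gMap, Es]

theorem hMap_Bs : hMap h v₁ v₂ Bs = Bd * hsh * incD v₁ * hsh⁻¹ := by simp [hMap, Bs]

theorem hMap_Es : hMap h v₁ v₂ Es = hsh * incD v₂ * hsh * Ed := by simp [hMap, Es]

/-- The action of `F(Δ')` on reduced words over the permutation group of `ℤ × F(Δ)`. -/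
noncomputable def targetPerm (D : Type*) : FreeGroup (Del' D) →*
    Equiv.Perm (AltWord.Normal (Equiv.Perm (ℤ × FreeGroup D))) :=
  FreeGroup.lift (Sum.elim
    (fun d => AltWord.coeffPerm (fibreMul (FreeGroup D) (FreeGroup.of d)))
    ![AltWord.letterPerm false, AltWord.letterPerm true, AltWord.coeffPerm (shift (FreeGroup D))])

theorem targetPerm_incD (p : FreeGroup D) :
    targetPerm D (incD p) = AltWord.coeffPerm (fibreMul (FreeGroup D) p) := by
  have : (targetPerm D).comp incD = AltWord.coeffPerm.comp (fibreMul (FreeGroup D)) := by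
    ext1 z
    simp [targetPerm, incD]
  exact DFunLike.congr_fun this p

theorem targetPerm_hsh :
    targetPerm D hsh = AltWord.coeffPerm (shift (FreeGroup D)) := by simp [targetPerm, hsh]

theorem targetPerm_Bd : targetPerm D Bd = AltWord.letterPerm false := by simp [targetPerm, Bd]

theorem targetPerm_Ed : targetPerm D Ed = AltWord.letterPerm true := by simp [targetPerm, Ed]

theorem eval_subst_gCoeff (s : AltWord (FreeGroup S)) :
    (s.subst ((conjLeft _).comp g) (gCoeff u₁ u₂) 1).eval AltWord.coeffPerm AltWord.letterPerm =
      targetPerm D (gMap g u₁ u₂ (s.eval incS fun b => FreeGroup.of (Sum.inr b))) := by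
  refine (AltWord.eval_subst incS (fun b => FreeGroup.of (Sum.inr b)) _ _ ((targetPerm D).comp (gMap g u₁ u₂)) _ _ ?_ ?_ _ _).trans ?_
  · intro a
    simp [gMap_incS, targetPerm_incD, targetPerm_hsh, conjLeft_apply]
  · rintro (_ | _)
    · change targetPerm D (gMap g u₁ u₂ Bs) = _
      simp [gMap_Bs, gCoeff, targetPerm_incD, targetPerm_hsh, targetPerm_Bd, mul_assoc]
    · change targetPerm D (gMap g u₁ u₂ Es) = _
      simp [gMap_Es, gCoeff, targetPerm_incD, targetPerm_hsh, targetPerm_Ed, mul_assoc]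
  · simp

theorem eval_subst_hCoeff (s : AltWord (FreeGroup S)) :
    (s.subst ((conjRight _).comp h) (hCoeff v₁ v₂) 1).eval AltWord.coeffPerm AltWord.letterPerm =
      targetPerm D (hMap h v₁ v₂ (s.eval incS fun b => FreeGroup.of (Sum.inr b))) := by
  refine (AltWord.eval_subst incS (fun b => FreeGroup.of (Sum.inr b)) _ _ ((targetPerm D).comp (hMap h v₁ v₂)) _ _ ?_ ?_ _ _).trans ?_
  · intro a
    simp [hMap_incS, targetPerm_incD, targetPerm_hsh, conjRight_apply]
  · rintro (_ | _)
    · change targetPerm D (hMap h v₁ v₂ Bs) = _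
      simp [hMap_Bs, hCoeff, targetPerm_incD, targetPerm_hsh, targetPerm_Bd, mul_assoc]
    · change targetPerm D (hMap h v₁ v₂ Es) = _
      simp [hMap_Es, hCoeff, targetPerm_incD, targetPerm_hsh, targetPerm_Ed, mul_assoc]
  · simp

/-- The elements of the equaliser of one of the four special forms. -/
def specialSolutions : Set (FreeGroup (Sig' S)) :=
  {s | gMap g u₁ u₂ s = hMap h v₁ v₂ s ∧
    ∃ x : FreeGroup S,
      s = Bs * incS x * Es ∨ s = (Bs * incS x * Es)⁻¹ ∨
      s = Es⁻¹ * incS x * Es ∨ s = Bs * incS x * Bs⁻¹}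

variable {g h u₁ u₂ v₁ v₂}

theorem Bs_mul_Es_mem {x : FreeGroup S} (hx : u₁ * g x * u₂ = v₁ * h x * v₂) :
    Bs * incS x * Es ∈ specialSolutions g h u₁ u₂ v₁ v₂ := by
  refine ⟨?_, x, Or.inl rfl⟩
  have := congrArg (fun p => Bd * hsh * incD p * hsh * Ed) hx
  simpa [gMap_Bs, gMap_Es, hMap_Bs, hMap_Es, gMap_incS, hMap_incS, mul_assoc] using this

theorem Es_inv_mul_Bs_inv_mem {x : FreeGroup S}
    (hx : u₂⁻¹ * g x * u₁⁻¹ = v₂⁻¹ * h x * v₁⁻¹) :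
    Es⁻¹ * incS x * Bs⁻¹ ∈ specialSolutions g h u₁ u₂ v₁ v₂ := by
  refine ⟨?_, x⁻¹, Or.inr (Or.inl (by simp [mul_assoc]))⟩
  have := congrArg (fun p => Ed⁻¹ * hsh⁻¹ * incD p * hsh⁻¹ * Bd⁻¹) hx
  simpa [gMap_Bs, gMap_Es, hMap_Bs, hMap_Es, gMap_incS, hMap_incS, mul_assoc] using this

theorem Es_inv_mul_Es_mem {x : FreeGroup S} (hx : u₂⁻¹ * g x * u₂ = v₂⁻¹ * h x * v₂) :
    Es⁻¹ * incS x * Es ∈ specialSolutions g h u₁ u₂ v₁ v₂ := by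
  refine ⟨?_, x, Or.inr (Or.inr (Or.inl rfl))⟩
  have := congrArg (fun p => Ed⁻¹ * hsh⁻¹ * incD p * hsh * Ed) hx
  simpa [gMap_Bs, gMap_Es, hMap_Bs, hMap_Es, gMap_incS, hMap_incS, mul_assoc] using this

theorem Bs_mul_Bs_inv_mem {x : FreeGroup S} (hx : u₁ * g x * u₁⁻¹ = v₁ * h x * v₁⁻¹) :
    Bs * incS x * Bs⁻¹ ∈ specialSolutions g h u₁ u₂ v₁ v₂ := by
  refine ⟨?_, x, Or.inr (Or.inr (Or.inr rfl))⟩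
  have := congrArg (fun p => Bd * hsh * incD p * hsh⁻¹ * Bd⁻¹) hx
  simpa [gMap_Bs, gMap_Es, hMap_Bs, hMap_Es, gMap_incS, hMap_incS, mul_assoc] using this

theorem eq_one_of_map_eq_one (hinj : Function.Injective g ∨ Function.Injective h)
    {a : FreeGroup S} (hg : g a = 1) (hh : h a = 1) : a = 1 := by
  rcases hinj with hi | hi
  · exact (map_eq_one_iff g hi).1 hg
  · exact (map_eq_one_iff h hi).1 hh

/-- Formal agreement of the two substitutions splits a word into special solutions. The second and
third parts concern words read after an opening letter `B`, respectively `E⁻¹`. -/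
theorem eval_mem_closure (hinj : Function.Injective g ∨ Function.Injective h)
    (s : AltWord (FreeGroup S)) :
    (s.subst ((conjLeft _).comp g) (gCoeff u₁ u₂) 1 =
        s.subst ((conjRight _).comp h) (hCoeff v₁ v₂) 1 →
      s.eval incS (fun b => FreeGroup.of (Sum.inr b)) ∈
        Submonoid.closure (specialSolutions g h u₁ u₂ v₁ v₂)) ∧
    (s.subst ((conjLeft _).comp g) (gCoeff u₁ u₂) (gCoeff u₁ u₂ false true) =
        s.subst ((conjRight _).comp h) (hCoeff v₁ v₂) (hCoeff v₁ v₂ false true) →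
      Bs * s.eval incS (fun b => FreeGroup.of (Sum.inr b)) ∈
        Submonoid.closure (specialSolutions g h u₁ u₂ v₁ v₂)) ∧
    (s.subst ((conjLeft _).comp g) (gCoeff u₁ u₂) (gCoeff u₁ u₂ true false) =
        s.subst ((conjRight _).comp h) (hCoeff v₁ v₂) (hCoeff v₁ v₂ true false) →
      Es⁻¹ * s.eval incS (fun b => FreeGroup.of (Sum.inr b)) ∈
        Submonoid.closure (specialSolutions g h u₁ u₂ v₁ v₂)) := by
  induction s with
  | nil a =>
    refine ⟨fun hs => ?_, fun hs => ?_, fun hs => ?_⟩ <;>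
      simp only [AltWord.subst, AltWord.nil.injEq] at hs
    · rw [one_mul, one_mul] at hs
      obtain ⟨hg, hh⟩ := eq_one_of_conjLeft_eq_conjRight hs
      obtain rfl := eq_one_of_map_eq_one hinj hg hh
      simp [AltWord.eval]
    all_goals
      have := congrArg (fun f => (f ((0 : ℤ), (1 : FreeGroup D))).1) hs
      simp [gCoeff, hCoeff, conjLeft_apply, conjRight_apply, fibreMul_apply, fibreMul_symm_apply,
        shift_apply, shift_symm_apply] at this
  | cons a y e t ih =>
    obtain ⟨ih1, ihB, ihE⟩ := ih
    refine ⟨fun hs => ?_, fun hs => ?_, fun hs => ?_⟩ <;>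
      simp only [AltWord.subst, AltWord.cons.injEq, true_and] at hs <;>
      obtain ⟨ha, ht⟩ := hs <;>
      have h0 := congrArg (fun f => (f ((0 : ℤ), (1 : FreeGroup D))).1) ha <;>
      have h1 := congrArg (fun f => (f ((1 : ℤ), (1 : FreeGroup D))).2) ha <;>
      have h2 := congrArg (fun f => (f ((-1 : ℤ), (1 : FreeGroup D))).2) ha <;>
      rcases y with _ | _ <;> rcases e with _ | _ <;>
      simp [gCoeff, hCoeff, conjLeft_apply, conjRight_apply, fibreMul_apply, fibreMul_symm_apply,
        shift_apply, shift_symm_apply] at h0 h1 h2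
    · obtain rfl := eq_one_of_map_eq_one hinj h2 h1.symm
      simpa [AltWord.eval, signed, Bs] using ihB ht
    · obtain rfl := eq_one_of_map_eq_one hinj h2 h1.symm
      simpa [AltWord.eval, signed, Es] using ihE ht
    · convert mul_mem (Submonoid.subset_closure (Bs_mul_Bs_inv_mem (by simpa [mul_assoc] using h1)))
        (ih1 ht) using 1
      simp [AltWord.eval, signed, Bs, mul_assoc]
    · convert mul_mem (Submonoid.subset_closure (Bs_mul_Es_mem (by simpa [mul_assoc] using h2)))
        (ih1 ht) using 1
      simp [AltWord.eval, signed, Bs, Es, mul_assoc]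
    · convert mul_mem (Submonoid.subset_closure (Es_inv_mul_Bs_inv_mem (by simpa [mul_assoc] using h1)))
        (ih1 ht) using 1
      simp [AltWord.eval, signed, Bs, Es, mul_assoc]
    · convert mul_mem (Submonoid.subset_closure (Es_inv_mul_Es_mem (by simpa [mul_assoc] using h2)))
        (ih1 ht) using 1
      simp [AltWord.eval, signed, Es, mul_assoc]

end

end PCP

open PCP in
/-- If at least one of `g, h` is injective, every element of the equaliser of `g'` and `h'`
is a product of elements of the equaliser of the forms `(B·ιΣ(x)·E)^{±1}`, `E⁻¹·ιΣ(x)·E`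
or `B·ιΣ(x)·B⁻¹`. -/
theorem equaliser_generated_by_special_solutions {S D : Type*}
    (g h : FreeGroup S →* FreeGroup D) (u₁ u₂ v₁ v₂ : FreeGroup D)
    (hinj : Function.Injective g ∨ Function.Injective h)
    (w : FreeGroup (Sig' S)) (hw : gMap g u₁ u₂ w = hMap h v₁ v₂ w) :
    ∃ l : List (FreeGroup (Sig' S)), w = l.prod ∧
      ∀ s ∈ l, gMap g u₁ u₂ s = hMap h v₁ v₂ s ∧
        ∃ x : FreeGroup S,
          s = Bs * incS x * Es ∨ s = (Bs * incS x * Es)⁻¹ ∨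
          s = Es⁻¹ * incS x * Es ∨ s = Bs * incS x * Bs⁻¹ := by
  obtain ⟨s, hs, rfl⟩ := AltWord.exists_red_eval w
  have heval := congrArg (targetPerm D) hw
  rw [← eval_subst_gCoeff, ← eval_subst_hCoeff] at heval
  have hsub : s.subst ((conjLeft _).comp g) (gCoeff u₁ u₂) 1 =
      s.subst ((conjRight _).comp h) (hCoeff v₁ v₂) 1 := by
    rcases hinj with hi | hi
    · exact hs.subst_eq (φ := (conjLeft _).comp g) (conjLeft_injective.comp hi) _ _ _ _ _ heval
    · exact (hs.subst_eq (φ := (conjRight _).comp h) (conjRight_injective.comp hi) _ _ _ _ _ heval.symm).symm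
  obtain ⟨l, hl, hprod⟩ :=
    Submonoid.exists_list_of_mem_closure ((eval_mem_closure hinj s).1 hsub)
  exact ⟨l, hprod.symm, hl⟩
end

section
/- Suppose at least one of g, h is injective, that there is no non-trivial x ∈ F(Σ) with u₁·g(x)·u₁⁻¹ = v₁·h(x)·v₁⁻¹, and that there is no non-trivial x ∈ F(Σ) with u₂⁻¹·g(x)·u₂ = v₂⁻¹·h(x)·v₂. Then every non-trivial element w of the equaliser Eq(g', h') = {w ∈ F(Σ') : g'(w) = h'(w)} can be written as a product w = s₁·s₂·⋯·s_n with n ≥ 1, where each s_i = (B·ιΣ(x_i)·E)^{ε_i} for some ε_i ∈ {1, −1} and some x_i ∈ F(Σ) satisfying u₁·g(x_i)·u₂ = v₁·h(x_i)·v₂. -/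
namespace PCP

section NormalForm

variable {A T : Type*}

/-- The inverse of a signed letter. -/
def flip (c : T × Bool) : T × Bool := (c.1, !c.2)

@[simp] lemma flip_flip (c : T × Bool) : flip (flip c) = c := by simp [flip]

/-- `(a₀, [(c₁, a₁), …, (cₙ, aₙ)])` represents the element `a₀ c₁ a₁ ⋯ cₙ aₙ` of
`F(A) * F(T)`. -/
abbrev Form (A T : Type*) := FreeGroup A × List ((T × Bool) × FreeGroup A)

/-- No two consecutive letters of the form cancel. -/
def Reduced (l : List ((T × Bool) × FreeGroup A)) : Prop :=
  l.IsChain fun p q => p.2 = 1 → q.1 ≠ flip p.1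

/-- The element of `F(A ⊔ T)` given by a signed letter. -/
def letter (c : T × Bool) : FreeGroup (A ⊕ T) := FreeGroup.mk [(Sum.inr c.1, c.2)]

lemma letter_flip (c : T × Bool) : (letter (flip c) : FreeGroup (A ⊕ T)) = (letter c)⁻¹ := by
  simp [letter, flip, FreeGroup.inv_mk, FreeGroup.invRev]

/-- The product of the letters of a form, preceded by its initial element. -/
def eval : FreeGroup A → List ((T × Bool) × FreeGroup A) → FreeGroup (A ⊕ T)
  | a, [] => FreeGroup.map Sum.inl a
  | a, p :: l => FreeGroup.map Sum.inl a * letter p.1 * eval p.2 l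

lemma eval_mul (a b : FreeGroup A) (l : List ((T × Bool) × FreeGroup A)) :
    eval (a * b) l = FreeGroup.map Sum.inl a * eval b l := by
  cases l <;> simp [eval, mul_assoc]

open Classical in
/-- Multiplication of a reduced form by a letter on the left. -/
noncomputable def push (c : T × Bool) : Form A T → Form A T
  | (a, []) => (1, [(c, a)])
  | (a, p :: l) => if a = 1 ∧ p.1 = flip c then (p.2, l) else (1, (c, a) :: p :: l)

lemma push_reduced (c : T × Bool) (x : Form A T) (hx : Reduced x.2) : Reduced (push c x).2 := by
  obtain ⟨a, _ | ⟨p, l⟩⟩ := x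
  · simp [push, Reduced]
  · by_cases h : a = 1 ∧ p.1 = flip c
    · simp only [push, if_pos h]
      exact List.IsChain.tail hx
    · simp only [push, if_neg h]
      exact List.IsChain.cons_cons (fun h1 h2 => h ⟨h1, h2⟩) hx

lemma push_push_flip (c : T × Bool) (x : Form A T) (hx : Reduced x.2) :
    push c (push (flip c) x) = x := by
  obtain ⟨a, _ | ⟨⟨d, b⟩, l⟩⟩ := x
  · simp [push]
  · by_cases h : a = 1 ∧ d = c
    · obtain ⟨rfl, rfl⟩ := h
      simp only [push, flip_flip, and_self, if_true]
      cases l with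
      | nil => rfl
      | cons q l =>
        have hq : ¬ (b = 1 ∧ q.1 = flip d) := fun h =>
          (List.isChain_cons_cons.1 hx).1 h.1 h.2
        simp only [if_neg hq]
    · simp [push, h]

lemma eval_push (c : T × Bool) (x : Form A T) :
    eval (push c x).1 (push c x).2 = letter c * eval x.1 x.2 := by
  obtain ⟨a, _ | ⟨p, l⟩⟩ := x
  · simp [push, eval]
  · by_cases h : a = 1 ∧ p.1 = flip c
    · simp [push, eval, h.1, h.2, letter_flip]
    · simp [push, if_neg h, eval]

/-- Reduced forms. -/
abbrev RForm (A T : Type*) := {x : Form A T // Reduced x.2}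

/-- Left multiplication of reduced forms by a letter, as a permutation. -/
noncomputable def pushPerm (c : T × Bool) : Equiv.Perm (RForm A T) where
  toFun x := ⟨push c x.1, push_reduced c x.1 x.2⟩
  invFun x := ⟨push (flip c) x.1, push_reduced _ x.1 x.2⟩
  left_inv x := Subtype.ext <| by
    simpa using push_push_flip (flip c) x.1 x.2
  right_inv x := Subtype.ext <| push_push_flip c x.1 x.2

/-- Left multiplication of reduced forms by elements of `F(A)`. -/
def baseAct : FreeGroup A →* Equiv.Perm (RForm A T) where
  toFun a :=
    { toFun := fun x => ⟨(a * x.1.1, x.1.2), x.2⟩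
      invFun := fun x => ⟨(a⁻¹ * x.1.1, x.1.2), x.2⟩
      left_inv := fun x => by simp
      right_inv := fun x => by simp }
  map_one' := by ext x <;> simp
  map_mul' a b := by ext x <;> simp [mul_assoc]

/-- The action of `F(A ⊔ T)` on reduced forms. -/
noncomputable def act : FreeGroup (A ⊕ T) →* Equiv.Perm (RForm A T) :=
  FreeGroup.lift (Sum.elim (fun a => baseAct (FreeGroup.of a)) fun t => pushPerm (t, true))

lemma act_base (a : FreeGroup A) :
    act (FreeGroup.map Sum.inl a) = (baseAct a : Equiv.Perm (RForm A T)) := by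
  have : (act.comp (FreeGroup.map Sum.inl) : FreeGroup A →* Equiv.Perm (RForm A T)) = baseAct := by
    ext1 s
    simp [act]
  exact DFunLike.congr_fun this a

lemma act_letter (c : T × Bool) : act (letter c) = (pushPerm c : Equiv.Perm (RForm A T)) := by
  obtain ⟨t, _ | _⟩ := c
  · have h : (letter (t, false) : FreeGroup (A ⊕ T)) = (FreeGroup.of (Sum.inr t))⁻¹ := rfl
    rw [h, map_inv, act, FreeGroup.lift_apply_of]
    ext1 x
    rfl
  · have h : (letter (t, true) : FreeGroup (A ⊕ T)) = FreeGroup.of (Sum.inr t) := rfl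
    rw [h, act, FreeGroup.lift_apply_of]
    rfl

/-- The reduced form of an element of `F(A ⊔ T)`. -/
noncomputable def nf (w : FreeGroup (A ⊕ T)) : RForm A T := act w ⟨(1, []), List.isChain_nil⟩

lemma eval_act (w : FreeGroup (A ⊕ T)) :
    ∀ x : RForm A T, eval (act w x).1.1 (act w x).1.2 = w * eval x.1.1 x.1.2 := by
  induction w using FreeGroup.induction_on with
  | C1 => simp
  | of z =>
    intro x
    rcases z with a | t
    · rw [← FreeGroup.map.of, act_base]
      exact eval_mul _ _ _
    · change eval (act (letter (t, true)) x).1.1 _ = letter (t, true) * _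
      rw [act_letter]
      exact eval_push _ _
  | inv_of z hz =>
    intro x
    have h := hz ((act (FreeGroup.of z))⁻¹ x)
    rw [← Equiv.Perm.mul_apply, mul_inv_cancel, Equiv.Perm.one_apply] at h
    rw [map_inv, h, inv_mul_cancel_left]
  | mul v w hv hw =>
    intro x
    rw [map_mul, Equiv.Perm.mul_apply, hv, hw, mul_assoc]

lemma eval_nf (w : FreeGroup (A ⊕ T)) : eval (nf w).1.1 (nf w).1.2 = w := by
  rw [nf, eval_act]
  simp [eval]

lemma nf_eval_nil (a : FreeGroup A) : (nf (eval a ([] : List ((T × Bool) × _)))).1 = (a, []) := by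
  rw [nf, eval, act_base]
  simp [baseAct]

lemma nf_eval_cons (a : FreeGroup A) (p : (T × Bool) × FreeGroup A) (l) :
    (nf (eval a (p :: l))).1 = (a * (push p.1 (nf (eval p.2 l)).1).1,
      (push p.1 (nf (eval p.2 l)).1).2) := by
  rw [nf, eval, map_mul, map_mul, act_base, act_letter]
  rfl

lemma nf_eval_of_reduced {l : List ((T × Bool) × FreeGroup A)} :
    ∀ a, Reduced l → (nf (eval a l)).1 = (a, l) := by
  induction l with
  | nil => exact fun a _ => nf_eval_nil a
  | cons p l ih =>
    intro a hl
    rw [nf_eval_cons, ih _ (List.IsChain.tail hl)]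
    cases l with
    | nil => simp [push]
    | cons q l =>
      have hq : ¬ (p.2 = 1 ∧ q.1 = flip p.1) := fun h =>
        (List.isChain_cons_cons.1 hl).1 h.1 h.2
      simp [push, if_neg hq]

lemma nf_eval_length (l : List ((T × Bool) × FreeGroup A)) :
    ∀ a, (nf (eval a l)).1.2.length ≤ l.length ∧
      ((nf (eval a l)).1.2.length = l.length → (nf (eval a l)).1 = (a, l)) := by
  induction l with
  | nil => simp [nf_eval_nil]
  | cons p l ih =>
    intro a
    obtain ⟨h1, h2⟩ := ih p.2
    rw [nf_eval_cons]
    generalize (nf (eval p.2 l)).1 = x at h1 h2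
    obtain ⟨b, _ | ⟨q, m⟩⟩ := x
    · simp only [push, List.length_cons, List.length_nil] at h1 h2 ⊢
      refine ⟨by omega, fun h => ?_⟩
      have := h2 (by omega)
      simp_all
    · by_cases hc : b = 1 ∧ q.1 = flip p.1
      · simp only [push, if_pos hc, List.length_cons] at h1 h2 ⊢
        exact ⟨by omega, fun h => by omega⟩
      · simp only [push, if_neg hc, List.length_cons] at h1 h2 ⊢
        refine ⟨by omega, fun h => ?_⟩
        have := h2 (by omega)
        simp_all

/-- A form representing the same element as a reduced form of the same length is equal to it. -/
lemma form_unique {a b : FreeGroup A} {l m : List ((T × Bool) × FreeGroup A)}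
    (hl : Reduced l) (hlen : l.length = m.length) (h : eval a l = eval b m) :
    (a, l) = (b, m) := by
  have h1 := nf_eval_of_reduced a hl
  rw [h] at h1
  rw [← h1]
  exact (nf_eval_length m b).2 (by rw [h1, hlen])

end NormalForm

section Transport

variable {A A' T : Type*}

/-- The left factor in the image of a signed letter, when `t` is sent to `p t * t * q t`. -/
def lft (p q : T → FreeGroup A') (c : T × Bool) : FreeGroup A' :=
  if c.2 then p c.1 else (q c.1)⁻¹

/-- The right factor in the image of a signed letter, when `t` is sent to `p t * t * q t`. -/
def rgt (p q : T → FreeGroup A') (c : T × Bool) : FreeGroup A' :=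
  if c.2 then q c.1 else (p c.1)⁻¹

lemma lft_flip (p q : T → FreeGroup A') (c : T × Bool) :
    lft p q (flip c) = (rgt p q c)⁻¹ := by
  obtain ⟨t, _ | _⟩ := c <;> simp [lft, rgt, flip]

/-- The image of a form under the homomorphism acting as `φ` on the base and sending each letter
`t` to `p t * t * q t`, multiplied by `r` on the left. -/
def transport (φ : FreeGroup A →* FreeGroup A') (p q : T → FreeGroup A') :
    FreeGroup A' → FreeGroup A → List ((T × Bool) × FreeGroup A) → Form A' T
  | r, x, [] => (r * φ x, [])
  | r, x, (c, y) :: l =>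
    (r * φ x * lft p q c,
      (c, (transport φ p q (rgt p q c) y l).1) :: (transport φ p q (rgt p q c) y l).2)

variable (φ : FreeGroup A →* FreeGroup A') (p q : T → FreeGroup A')

lemma transport_length (l : List ((T × Bool) × FreeGroup A)) :
    ∀ r x, (transport φ p q r x l).2.length = l.length := by
  induction l with
  | nil => intros; rfl
  | cons a l ih => intro r x; simp [transport, ih]

lemma eval_transport (f : FreeGroup (A ⊕ T) →* FreeGroup (A' ⊕ T))
    (hA : ∀ x, f (FreeGroup.map Sum.inl x) = FreeGroup.map Sum.inl (φ x))
    (hT : ∀ t, f (FreeGroup.of (Sum.inr t)) =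
      FreeGroup.map Sum.inl (p t) * FreeGroup.of (Sum.inr t) * FreeGroup.map Sum.inl (q t))
    (l : List ((T × Bool) × FreeGroup A)) :
    ∀ r x, eval (transport φ p q r x l).1 (transport φ p q r x l).2 =
      FreeGroup.map Sum.inl r * f (eval x l) := by
  have hc : ∀ c : T × Bool, f (letter c) = FreeGroup.map Sum.inl (lft p q c) * letter c *
      FreeGroup.map Sum.inl (rgt p q c) := by
    rintro ⟨t, _ | _⟩
    · change f (FreeGroup.of (Sum.inr t))⁻¹ = _ * (FreeGroup.of (Sum.inr t))⁻¹ * _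
      rw [map_inv, hT]
      simp [lft, rgt, mul_assoc]
    · change f (FreeGroup.of (Sum.inr t)) = _ * FreeGroup.of (Sum.inr t) * _
      rw [hT]
      simp [lft, rgt]
  induction l with
  | nil => intro r x; simp [transport, eval, hA]
  | cons a l ih =>
    intro r x
    simp only [transport, eval, ih, map_mul, hA, hc, mul_assoc]

lemma transport_reduced (hφ : Function.Injective φ) (l : List ((T × Bool) × FreeGroup A)) :
    ∀ r x, Reduced l → Reduced (transport φ p q r x l).2 := by
  induction l with
  | nil => intro r x _; exact List.isChain_nil
  | cons a l ih =>
    intro r x hl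
    obtain ⟨c, y⟩ := a
    have hi := ih (rgt p q c) y (List.IsChain.tail hl)
    cases l with
    | nil => exact List.isChain_singleton _
    | cons b l =>
      obtain ⟨d, z⟩ := b
      simp only [transport] at hi ⊢
      refine List.IsChain.cons_cons (fun h1 h2 => ?_) hi
      simp only at h1 h2
      subst h2
      refine (List.isChain_cons_cons.1 hl).1 ?_ rfl
      rw [lft_flip, mul_inv_eq_one] at h1
      exact hφ (by simpa using h1)

end Transport

section Hash

variable {D : Type*}

/-- The inclusion of `F(Δ)` in `F(Δ ⊔ {#})`. -/
def base : FreeGroup D →* FreeGroup (D ⊕ Unit) := FreeGroup.map Sum.inl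

/-- The letter `#` in `F(Δ ⊔ {#})`. -/
def hash : FreeGroup (D ⊕ Unit) := FreeGroup.of (Sum.inr ())

lemma base_injective : Function.Injective (base : FreeGroup D → _) :=
  FreeGroup.map_injective Sum.inl_injective

/-- The exponent sum of `#`. -/
def hashSum : FreeGroup (D ⊕ Unit) →* Multiplicative ℤ :=
  FreeGroup.lift (Sum.elim 1 fun _ => Multiplicative.ofAdd 1)

@[simp] lemma hashSum_base (x : FreeGroup D) : hashSum (base x) = 1 := by
  have : (hashSum.comp base : FreeGroup D →* _) = 1 := by
    ext1 s
    simp [hashSum, base]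
  exact DFunLike.congr_fun this x

@[simp] lemma hashSum_hash : hashSum (hash : FreeGroup (D ⊕ Unit)) = Multiplicative.ofAdd 1 := by
  simp [hashSum, hash]

lemma eq_one_of_hash_conj {a b : FreeGroup D}
    (h : hash⁻¹ * base a * hash = hash * base b * hash⁻¹) : a = 1 ∧ b = 1 := by
  have h1 : eval a [(((), true), 1), (((), true), 1)] =
      eval 1 [(((), true), 1), (((), true), b)] := by
    change base a * hash * (base 1 * hash * base 1) = base 1 * hash * (base 1 * hash * base b)
    have h' := congrArg (fun z => hash * z * hash) h
    simpa [mul_assoc] using h'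
  have h2 := form_unique (l := [(((), true), 1), (((), true), 1)])
    (m := [(((), true), 1), (((), true), b)]) (by simp [Reduced, flip]) rfl h1
  simp_all

end Hash

section Segments

variable {S D : Type*}

/-- The homomorphism `x ↦ k * φ x * k⁻¹` into `F(Δ ⊔ {#})`. -/
def conjHom (k : FreeGroup (D ⊕ Unit)) (φ : FreeGroup S →* FreeGroup D) :
    FreeGroup S →* FreeGroup (D ⊕ Unit) :=
  (MulAut.conj k).toMonoidHom.comp (base.comp φ)

lemma conjHom_apply (k : FreeGroup (D ⊕ Unit)) (φ : FreeGroup S →* FreeGroup D)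
    (x : FreeGroup S) : conjHom k φ x = k * base (φ x) * k⁻¹ := rfl

lemma conjHom_injective (k : FreeGroup (D ⊕ Unit)) {φ : FreeGroup S →* FreeGroup D}
    (hφ : Function.Injective φ) : Function.Injective (conjHom k φ) :=
  (MulAut.conj k).injective.comp (base_injective.comp hφ)

/-- The factor of `g'(z)` or `h'(z)` preceding the letter `z ∈ {B, E}`. -/
def leftFactor (e : FreeGroup (D ⊕ Unit)) : Bool → FreeGroup (D ⊕ Unit)
  | false => 1
  | true => e

/-- The factor of `g'(z)` or `h'(z)` following the letter `z ∈ {B, E}`. -/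
def rightFactor (b : FreeGroup (D ⊕ Unit)) : Bool → FreeGroup (D ⊕ Unit)
  | false => b
  | true => 1

/-- The regrouping of `Δ ⊔ {B, E, #}` as `(Δ ⊔ {#}) ⊔ {B, E}`. -/
def regroup : FreeGroup (Del' D) →* FreeGroup ((D ⊕ Unit) ⊕ Bool) :=
  FreeGroup.map (Sum.elim (fun d => Sum.inl (Sum.inl d))
    ![Sum.inr false, Sum.inr true, Sum.inl (Sum.inr ())])

lemma regroup_incD (x : FreeGroup D) :
    regroup (incD x) = FreeGroup.map Sum.inl (base x) := by
  have : (regroup.comp incD : FreeGroup D →* _) = (FreeGroup.map Sum.inl).comp base := by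
    ext1 d
    simp [regroup, incD, base]
  exact DFunLike.congr_fun this x

lemma regroup_hsh :
    regroup (hsh : FreeGroup (Del' D)) = FreeGroup.map Sum.inl hash := by
  simp [regroup, hsh, hash]

lemma regroup_Bd :
    regroup (Bd : FreeGroup (Del' D)) = FreeGroup.of (Sum.inr false) := by
  simp [regroup, Bd]

lemma regroup_Ed :
    regroup (Ed : FreeGroup (Del' D)) = FreeGroup.of (Sum.inr true) := by
  simp [regroup, Ed]

variable (g h : FreeGroup S →* FreeGroup D) (u₁ u₂ v₁ v₂ : FreeGroup D)

/-- The form of `g'(w)` for a form of `w`. -/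
def gForm (r : FreeGroup (D ⊕ Unit)) (x : FreeGroup S)
    (l : List ((Bool × Bool) × FreeGroup S)) : Form (D ⊕ Unit) Bool :=
  transport (conjHom hash⁻¹ g) (leftFactor (hash⁻¹ * base u₂ * hash))
    (rightFactor (hash * base u₁ * hash)) r x l

/-- The form of `h'(w)` for a form of `w`. -/
def hForm (r : FreeGroup (D ⊕ Unit)) (x : FreeGroup S)
    (l : List ((Bool × Bool) × FreeGroup S)) : Form (D ⊕ Unit) Bool :=
  transport (conjHom hash h) (leftFactor (hash * base v₂ * hash))
    (rightFactor (hash * base v₁ * hash⁻¹)) r x l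

lemma eval_gForm (x : FreeGroup S) (l : List ((Bool × Bool) × FreeGroup S)) :
    eval (gForm g u₁ u₂ 1 x l).1 (gForm g u₁ u₂ 1 x l).2 =
      regroup (gMap g u₁ u₂ (eval x l)) := by
  rw [gForm, eval_transport _ _ _ (regroup.comp (gMap g u₁ u₂))]
  · simp
  · intro x
    have : ((regroup.comp (gMap g u₁ u₂)).comp (FreeGroup.map Sum.inl) : FreeGroup S →* _) =
        (FreeGroup.map Sum.inl).comp (conjHom hash⁻¹ g) := by
      ext1 s
      simp [gMap, regroup_hsh, regroup_incD, conjHom_apply]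
    exact DFunLike.congr_fun this x
  · rintro (_ | _) <;>
      simp [gMap, regroup_hsh, regroup_incD, regroup_Bd, regroup_Ed, leftFactor, rightFactor,
        mul_assoc]

lemma eval_hForm (x : FreeGroup S) (l : List ((Bool × Bool) × FreeGroup S)) :
    eval (hForm h v₁ v₂ 1 x l).1 (hForm h v₁ v₂ 1 x l).2 =
      regroup (hMap h v₁ v₂ (eval x l)) := by
  rw [hForm, eval_transport _ _ _ (regroup.comp (hMap h v₁ v₂))]
  · simp
  · intro x
    have : ((regroup.comp (hMap h v₁ v₂)).comp (FreeGroup.map Sum.inl) : FreeGroup S →* _) =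
        (FreeGroup.map Sum.inl).comp (conjHom hash h) := by
      ext1 s
      simp [hMap, regroup_hsh, regroup_incD, conjHom_apply]
    exact DFunLike.congr_fun this x
  · rintro (_ | _) <;>
      simp [hMap, regroup_hsh, regroup_incD, regroup_Bd, regroup_Ed, leftFactor, rightFactor,
        mul_assoc]

lemma gForm_eq_hForm (hinj : Function.Injective g ∨ Function.Injective h) {x : FreeGroup S}
    {l : List ((Bool × Bool) × FreeGroup S)} (hl : Reduced l)
    (he : gMap g u₁ u₂ (eval x l) = hMap h v₁ v₂ (eval x l)) :
    gForm g u₁ u₂ 1 x l = hForm h v₁ v₂ 1 x l := by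
  have he' := congrArg regroup he
  rw [← eval_gForm, ← eval_hForm] at he'
  have hlen : (gForm g u₁ u₂ 1 x l).2.length = (hForm h v₁ v₂ 1 x l).2.length := by
    simp [gForm, hForm, transport_length]
  rcases hinj with hg | hh
  · exact form_unique (transport_reduced _ _ _ (conjHom_injective _ hg) _ _ _ hl) hlen he'
  · exact (form_unique (transport_reduced _ _ _ (conjHom_injective _ hh) _ _ _ hl)
      hlen.symm he'.symm).symm

lemma gForm_eq_hForm_cons {r r' : FreeGroup (D ⊕ Unit)} {x y : FreeGroup S} {c : Bool × Bool}
    {l : List ((Bool × Bool) × FreeGroup S)}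
    (he : gForm g u₁ u₂ r x ((c, y) :: l) = hForm h v₁ v₂ r' x ((c, y) :: l)) :
    r * (hash⁻¹ * base (g x) * hash) *
        lft (leftFactor (hash⁻¹ * base u₂ * hash)) (rightFactor (hash * base u₁ * hash)) c =
      r' * (hash * base (h x) * hash⁻¹) *
        lft (leftFactor (hash * base v₂ * hash)) (rightFactor (hash * base v₁ * hash⁻¹)) c ∧
    gForm g u₁ u₂
        (rgt (leftFactor (hash⁻¹ * base u₂ * hash)) (rightFactor (hash * base u₁ * hash)) c) y l =
      hForm h v₁ v₂
        (rgt (leftFactor (hash * base v₂ * hash)) (rightFactor (hash * base v₁ * hash⁻¹)) c)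
        y l := by
  simp only [gForm, hForm, transport, conjHom_apply, inv_inv, Prod.mk.injEq, List.cons.injEq] at he
  exact ⟨he.1, Prod.ext he.2.1.2 he.2.2⟩

/-- A genuine block `B x E` or its inverse, where `x` is a solution of the instance. -/
def IsBlock (s : FreeGroup (Sig' S)) : Prop :=
  ∃ x : FreeGroup S, u₁ * g x * u₂ = v₁ * h x * v₂ ∧
    (s = Bs * incS x * Es ∨ s = (Bs * incS x * Es)⁻¹)

lemma ne_of_hashSum {a b : FreeGroup (D ⊕ Unit)} (hab : a = b)
    (hs : (hashSum a).toAdd ≠ (hashSum b).toAdd) : False := hs (by rw [hab])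

lemma exists_blocks (hinj : Function.Injective g ∨ Function.Injective h)
    (h1 : ¬ ∃ x : FreeGroup S, x ≠ 1 ∧ u₁ * g x * u₁⁻¹ = v₁ * h x * v₁⁻¹)
    (h2 : ¬ ∃ x : FreeGroup S, x ≠ 1 ∧ u₂⁻¹ * g x * u₂ = v₂⁻¹ * h x * v₂)
    (l : List ((Bool × Bool) × FreeGroup S)) (x : FreeGroup S) (hl : Reduced l)
    (he : gForm g u₁ u₂ 1 x l = hForm h v₁ v₂ 1 x l) :
    ∃ m : List (FreeGroup (Sig' S)), eval x l = m.prod ∧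
      ∀ s ∈ m, IsBlock g h u₁ u₂ v₁ v₂ s := by
  have outer : ∀ x, hash⁻¹ * base (g x) * hash = hash * base (h x) * hash⁻¹ → x = 1 := by
    intro x hx
    obtain ⟨hg, hh⟩ := eq_one_of_hash_conj hx
    rcases hinj with hi | hi
    · exact hi (by rw [hg, map_one])
    · exact hi (by rw [hh, map_one])
  match l with
  | [] =>
    have : x = 1 := outer x (by simpa [gForm, hForm, transport, conjHom_apply] using he)
    exact ⟨[], by simp [eval, this], by simp⟩
  | [(c, y)] =>
    exfalso
    obtain ⟨ha, hb⟩ := gForm_eq_hForm_cons _ _ _ _ _ _ he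
    simp only [gForm, hForm, transport, Prod.mk.injEq, and_true] at hb
    obtain ⟨_ | _, _ | _⟩ := c <;>
      first
      | (refine ne_of_hashSum ha ?_; simp [lft, leftFactor, rightFactor]; done)
      | (refine ne_of_hashSum hb ?_; simp [rgt, leftFactor, rightFactor, conjHom_apply])
  | (c, y) :: (d, z) :: l =>
    obtain ⟨ha, hb⟩ := gForm_eq_hForm_cons _ _ _ _ _ _ he
    obtain ⟨hb, hc⟩ := gForm_eq_hForm_cons _ _ _ _ _ _ hb
    obtain ⟨hcd, hl'⟩ := List.isChain_cons_cons.1 hl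
    have ih := exists_blocks hinj h1 h2 l z (List.IsChain.tail hl')
    obtain ⟨_ | _, _ | _⟩ := c <;> obtain ⟨_ | _, _ | _⟩ := d
    all_goals
      first
      | (refine (ne_of_hashSum ha ?_).elim; simp [lft, leftFactor, rightFactor]; done)
      | (refine (ne_of_hashSum hb ?_).elim; simp [lft, rgt, leftFactor, rightFactor]; done)
      | skip
    all_goals
      simp only [lft, rgt, leftFactor, rightFactor, if_true, Bool.false_eq_true, if_false,
        inv_one, one_mul, mul_one] at ha hb hc
      obtain rfl := outer x ha
    · refine absurd ?_ h1
      have hb' : base (u₁ * g y * u₁⁻¹) = base (v₁ * h y * v₁⁻¹) := by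
        simpa [mul_assoc] using congrArg (· * hash) hb
      exact ⟨y, fun hy => hcd hy rfl, base_injective hb'⟩
    · obtain ⟨m, hm, hm'⟩ := ih hc
      have hb' : base (u₁ * g y * u₂) = base (v₁ * h y * v₂) := by
        simpa [mul_assoc] using congrArg (· * hash⁻¹) hb
      refine ⟨(Bs * incS y * Es) :: m, ?_, List.forall_mem_cons.2
        ⟨⟨y, base_injective hb', Or.inl rfl⟩, hm'⟩⟩
      rw [List.prod_cons, ← hm]
      simp only [eval, map_one, one_mul, mul_assoc]
      rfl
    · obtain ⟨m, hm, hm'⟩ := ih hc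
      have hb' : base (u₁ * g y⁻¹ * u₂) = base (v₁ * h y⁻¹ * v₂) := by
        rw [← inv_inj]
        simpa [mul_assoc] using congrArg (· * hash) hb
      refine ⟨(Bs * incS y⁻¹ * Es)⁻¹ :: m, ?_, List.forall_mem_cons.2
        ⟨⟨y⁻¹, base_injective hb', Or.inr rfl⟩, hm'⟩⟩
      rw [List.prod_cons, ← hm]
      simp only [eval, map_one, map_inv, mul_inv_rev, inv_inv, one_mul, mul_assoc]
      rfl
    · refine absurd ?_ h2
      have hb' : base (u₂⁻¹ * g y * u₂) = base (v₂⁻¹ * h y * v₂) := by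
        simpa [mul_assoc] using congrArg (· * hash⁻¹) hb
      exact ⟨y, fun hy => hcd hy rfl, base_injective hb'⟩
termination_by l.length

end Segments

end PCP

open PCP in
/-- If at least one of `g, h` is injective and the instance has no solutions of the two
degenerate conjugacy forms, then every non-trivial element of the equaliser of `g'` and `h'`
is a non-empty product of elements `(B·ιΣ(x)·E)^{±1}` where `x` is a solution of the
GPCP instance. -/
theorem equaliser_generated_by_genuine_solutions {S D : Type*}
    (g h : FreeGroup S →* FreeGroup D) (u₁ u₂ v₁ v₂ : FreeGroup D)
    (hinj : Function.Injective g ∨ Function.Injective h)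
    (h1 : ¬ ∃ x : FreeGroup S, x ≠ 1 ∧ u₁ * g x * u₁⁻¹ = v₁ * h x * v₁⁻¹)
    (h2 : ¬ ∃ x : FreeGroup S, x ≠ 1 ∧ u₂⁻¹ * g x * u₂ = v₂⁻¹ * h x * v₂)
    (w : FreeGroup (Sig' S)) (hw : w ≠ 1) (hEq : gMap g u₁ u₂ w = hMap h v₁ v₂ w) :
    ∃ l : List (FreeGroup (Sig' S)), l ≠ [] ∧ w = l.prod ∧
      ∀ s ∈ l, ∃ x : FreeGroup S,
        u₁ * g x * u₂ = v₁ * h x * v₂ ∧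
        (s = Bs * incS x * Es ∨ s = (Bs * incS x * Es)⁻¹) := by
  obtain ⟨m, hm, hm'⟩ := exists_blocks g h u₁ u₂ v₁ v₂ hinj h1 h2 (nf w).1.2 (nf w).1.1 (nf w).2
    (gForm_eq_hForm g h u₁ u₂ v₁ v₂ hinj (nf w).2 (by rw [eval_nf, hEq]))
  rw [eval_nf] at hm
  refine ⟨m, ?_, hm, hm'⟩
  rintro rfl
  exact hw hm
end

section
/- For all choices of u₁, u₂, v₁, v₂ ∈ F(Δ) one has g'(B) ≠ h'(B) and g'(E) ≠ h'(E); in particular, neither the generator B nor the element E⁻¹ lies in the equaliser Eq(g', h') = {w ∈ F(Σ') : g'(w) = h'(w)}. -/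
namespace PCP

/-- The exponent sum of the letter `#`, as a homomorphism to `ℤ`. -/
def hshExponent {D : Type*} : FreeGroup (Del' D) →* Multiplicative ℤ :=
  FreeGroup.lift (Sum.elim 1 ![1, 1, Multiplicative.ofAdd 1])

@[simp] lemma hshExponent_Bd {D : Type*} : hshExponent (Bd : FreeGroup (Del' D)) = 1 := by
  simp [hshExponent, Bd]

@[simp] lemma hshExponent_Ed {D : Type*} : hshExponent (Ed : FreeGroup (Del' D)) = 1 := by
  simp [hshExponent, Ed]

@[simp] lemma hshExponent_hsh {D : Type*} :
    hshExponent (hsh : FreeGroup (Del' D)) = Multiplicative.ofAdd 1 := by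
  simp [hshExponent, hsh]

@[simp] lemma hshExponent_incD {D : Type*} (u : FreeGroup D) : hshExponent (incD u) = 1 := by
  have : hshExponent.comp (incD (D := D)) = 1 := by
    ext x
    simp [hshExponent, incD]
  exact DFunLike.congr_fun this u

lemma gMap_Bs_ne_hMap_Bs {S D : Type*} (g h : FreeGroup S →* FreeGroup D)
    (u₁ u₂ v₁ v₂ : FreeGroup D) : gMap g u₁ u₂ Bs ≠ hMap h v₁ v₂ Bs := by
  intro e
  have := congrArg hshExponent e
  simp only [gMap, hMap, Bs, FreeGroup.lift_apply_of, map_mul, map_inv, hshExponent_Bd,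
    hshExponent_hsh, hshExponent_incD] at this
  exact absurd this (by decide)

lemma gMap_Es_ne_hMap_Es {S D : Type*} (g h : FreeGroup S →* FreeGroup D)
    (u₁ u₂ v₁ v₂ : FreeGroup D) : gMap g u₁ u₂ Es ≠ hMap h v₁ v₂ Es := by
  intro e
  have := congrArg hshExponent e
  simp only [gMap, hMap, Es, FreeGroup.lift_apply_of, map_mul, map_inv, hshExponent_Ed,
    hshExponent_hsh, hshExponent_incD] at this
  exact absurd this (by decide)

end PCP

open PCP in
/-- For all `u₁, u₂, v₁, v₂` we have `g'(B) ≠ h'(B)` and `g'(E) ≠ h'(E)`; in particular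
neither `B` nor `E⁻¹` lies in the equaliser of `g'` and `h'`. -/
theorem markers_not_in_equaliser {S D : Type*}
    (g h : FreeGroup S →* FreeGroup D) (u₁ u₂ v₁ v₂ : FreeGroup D) :
    gMap g u₁ u₂ (Bs : FreeGroup (Sig' S)) ≠ hMap h v₁ v₂ Bs ∧
    gMap g u₁ u₂ (Es : FreeGroup (Sig' S)) ≠ hMap h v₁ v₂ Es ∧
    gMap g u₁ u₂ ((Bs : FreeGroup (Sig' S))) ≠ hMap h v₁ v₂ Bs ∧
    gMap g u₁ u₂ ((Es : FreeGroup (Sig' S))⁻¹) ≠ hMap h v₁ v₂ Es⁻¹ := by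
  refine ⟨gMap_Bs_ne_hMap_Bs g h u₁ u₂ v₁ v₂, gMap_Es_ne_hMap_Es g h u₁ u₂ v₁ v₂,
    gMap_Bs_ne_hMap_Bs g h u₁ u₂ v₁ v₂, fun e => gMap_Es_ne_hMap_Es g h u₁ u₂ v₁ v₂ ?_⟩
  rwa [map_inv, map_inv, inv_inj] at e
end

section
/- Suppose Σ is a finite alphabet. Then the rank (minimal number of generators) of the image of g' equals the rank of the image of g plus 2, and the rank of the image of h' equals the rank of the image of h plus 2: rk(Im(g')) = rk(Im(g)) + 2 and rk(Im(h')) = rk(Im(h)) + 2. -/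
/-- The rank of a subgroup `H` of a group `G`: the minimal cardinality of a subset of `G`
generating `H`. -/
noncomputable def subgroupRank {G : Type*} [Group G] (H : Subgroup G) : ℕ :=
  sInf {n : ℕ | ∃ s : Finset G, s.card = n ∧ Subgroup.closure (s : Set G) = H}

theorem Monoid.CoprodI.map_injective {ι : Type*} {H G : ι → Type*} [∀ i, Group (H i)]
    [∀ i, Group (G i)] (f : ∀ i, H i →* G i) (hf : ∀ i, Function.Injective (f i)) :
    Function.Injective (Monoid.CoprodI.lift fun i => Monoid.CoprodI.of.comp (f i)) := by
  classical
  have image_word : ∀ {i j} (w : Monoid.CoprodI.NeWord H i j),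
      ∃ w' : Monoid.CoprodI.NeWord G i j,
        Monoid.CoprodI.lift (fun i => Monoid.CoprodI.of.comp (f i)) w.prod = w'.prod := by
    intro i j w
    induction w with
    | singleton x hx =>
      exact ⟨.singleton (f _ x) ((map_ne_one_iff _ (hf _)).2 hx), by simp⟩
    | append w₁ hne w₂ ih₁ ih₂ =>
      obtain ⟨w₁', h₁⟩ := ih₁
      obtain ⟨w₂', h₂⟩ := ih₂
      exact ⟨.append w₁' hne w₂', by simp [h₁, h₂]⟩
  refine (injective_iff_map_eq_one _).2 fun x hx => ?_
  by_contra hne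
  obtain ⟨w, rfl⟩ : ∃ w : Monoid.CoprodI.Word H, w.prod = x :=
    ⟨Monoid.CoprodI.Word.equiv x, Monoid.CoprodI.Word.equiv.symm_apply_apply x⟩
  obtain ⟨i, j, w, rfl⟩ := Monoid.CoprodI.NeWord.of_word w fun h => hne (by simp [h])
  obtain ⟨w', hw'⟩ := image_word w
  have hone : w'.toWord.prod = (Monoid.CoprodI.Word.empty : Monoid.CoprodI.Word G).prod := by
    rw [Monoid.CoprodI.Word.prod_empty, ← hx]
    exact hw'.symm
  have hempty : w'.toWord = Monoid.CoprodI.Word.empty :=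
    Monoid.CoprodI.Word.equiv.symm.injective hone
  exact w'.toList_ne_nil (congrArg Monoid.CoprodI.Word.toList hempty)

/-- If the image of `p` surjects onto the free abelian group on `ι`, then every generating set of
this image has at least as many elements as `ι`. -/
theorem card_le_card_of_closure_eq_range {W P ι : Type*} [Group W] [Group P] (p : W →* P)
    (α : W →* Multiplicative (ι →₀ ℤ)) (hker : p.ker ≤ α.ker)
    (hα : ∀ i, Multiplicative.ofAdd (Finsupp.single i 1) ∈ α.range)
    (T : Finset P) (hT : Subgroup.closure (T : Set P) = p.range) :
    Finite ι ∧ Nat.card ι ≤ T.card := by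
  classical
  have hlift : ∀ t : T, ∃ w, p w = t := fun t => by
    have ht : (t : P) ∈ p.range := hT ▸ Subgroup.subset_closure t.2
    exact ht
  choose w hw using hlift
  let v : T → (ι →₀ ℤ) := fun t => (α (w t)).toAdd
  have hclosure : ∀ c ∈ Subgroup.closure (Set.range w),
      (α c).toAdd ∈ Submodule.span ℤ (Set.range v) := by
    intro c hc
    induction hc using Subgroup.closure_induction with
    | mem x hx =>
      obtain ⟨t, rfl⟩ := hx
      exact Submodule.subset_span ⟨t, rfl⟩
    | one => simp
    | mul x y _ _ hx hy => simpa using add_mem hx hy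
    | inv x _ hx => simpa using hx
  have hmap : (Subgroup.closure (Set.range w)).map p = p.range := by
    rw [MonoidHom.map_closure, ← hT, ← Set.range_comp]
    congr 1
    ext t
    simp [hw]
  have hspan : ∀ x, (α x).toAdd ∈ Submodule.span ℤ (Set.range v) := by
    intro x
    have hx : p x ∈ (Subgroup.closure (Set.range w)).map p := hmap ▸ ⟨x, rfl⟩
    obtain ⟨c, hc, hcx⟩ := hx
    have : α c = α x := by
      have : c⁻¹ * x ∈ α.ker := hker (by simp [MonoidHom.mem_ker, hcx])
      simpa [MonoidHom.mem_ker, inv_mul_eq_one] using this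
    exact this ▸ hclosure c hc
  have htop : Submodule.span ℤ (Set.range v) = ⊤ := by
    rw [eq_top_iff, ← (Finsupp.basisSingleOne (R := ℤ) (ι := ι)).span_eq, Submodule.span_le]
    rintro _ ⟨i, rfl⟩
    obtain ⟨x, hx⟩ := hα i
    simpa [hx] using hspan x
  have : Module.Finite ℤ (ι →₀ ℤ) :=
    ⟨⟨Finset.univ.image v, by simpa using htop⟩⟩
  have hfin : Finite ι := Module.Finite.finite_basis (Finsupp.basisSingleOne (R := ℤ) (ι := ι))
  refine ⟨hfin, ?_⟩
  have := Fintype.ofFinite ι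
  simpa using finrank_le_of_span_eq_top htop

theorem IsFreeGroup.closure_range_of {G : Type*} [Group G] [IsFreeGroup G] :
    Subgroup.closure (Set.range (IsFreeGroup.of : Generators G → G)) = ⊤ := by
  have h : (IsFreeGroup.of : Generators G → G) =
      (IsFreeGroup.mulEquiv G).toMonoidHom ∘ FreeGroup.of := by
    funext a
    simp [IsFreeGroup.of, IsFreeGroup.mulEquiv]
    rfl
  rw [h, Set.range_comp, ← MonoidHom.map_closure, FreeGroup.closure_range_of,
    ← MonoidHom.range_eq_map, MonoidHom.range_eq_top]
  exact (IsFreeGroup.mulEquiv G).surjective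

theorem subgroupRank_le_card {G : Type*} [Group G] {H : Subgroup G} (s : Finset G)
    (hs : Subgroup.closure (s : Set G) = H) : subgroupRank H ≤ s.card :=
  Nat.sInf_le ⟨s, rfl, hs⟩

theorem exists_card_eq_subgroupRank {G : Type*} [Group G] {H : Subgroup G}
    (hH : H.FG) : ∃ s : Finset G, s.card = subgroupRank H ∧ Subgroup.closure (s : Set G) = H := by
  obtain ⟨s, hs⟩ := hH
  exact Nat.sInf_mem (s := {n : ℕ | ∃ s : Finset G, s.card = n ∧ Subgroup.closure (s : Set G) = H})
    ⟨_, s, rfl, hs⟩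

theorem FreeGroup.fg_range_of_finite {A B : Type*} [Finite A] [Group B] (f : FreeGroup A →* B) :
    f.range.FG := by
  rw [MonoidHom.range_eq_map, ← FreeGroup.closure_range_of, MonoidHom.map_closure]
  exact Subgroup.fg_iff _ |>.2 ⟨_, rfl, (Set.finite_range _).image _⟩

/-- If `p` is, up to a homomorphism `κ`, an extension of `g`, and `θ` exhibits the image of `p` as
a free product of the image of `g` and a free group of rank two, then the rank goes up by two. -/
theorem subgroupRank_range_eq_add_two {S D P : Type*} [Finite S] [Group P]
    (g : FreeGroup S →* FreeGroup D) (p : FreeGroup (S ⊕ Bool) →* P) (κ : FreeGroup D →* P)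
    (θ : P →* Monoid.CoprodI fun _ : Bool => FreeGroup (D ⊕ Bool))
    (hpκ : ∀ s, p (FreeGroup.of (Sum.inl s)) = κ (g (FreeGroup.of s)))
    (hθκ : ∀ w, θ (κ w) = Monoid.CoprodI.of (i := true) (FreeGroup.map Sum.inl w))
    (hθp : ∀ b, θ (p (FreeGroup.of (Sum.inr b))) =
      Monoid.CoprodI.of (i := false) (FreeGroup.of (Sum.inr b))) :
    subgroupRank p.range = subgroupRank g.range + 2 := by
  classical
  have hpκ' : ∀ w, p (FreeGroup.map Sum.inl w) = κ (g w) := fun w =>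
    DFunLike.congr_fun (FreeGroup.ext_hom (f := p.comp (FreeGroup.map Sum.inl)) (g := κ.comp g)
      (by simpa using hpκ)) w
  apply le_antisymm
  · obtain ⟨s, hcard, hs⟩ := exists_card_eq_subgroupRank (FreeGroup.fg_range_of_finite g)
    refine (subgroupRank_le_card (insert (p (FreeGroup.of (Sum.inr false)))
      (insert (p (FreeGroup.of (Sum.inr true))) (s.image κ))) ?_).trans ?_
    · apply le_antisymm
      · rw [Subgroup.closure_le]
        intro x hx
        simp only [Finset.coe_insert, Finset.coe_image, Set.mem_insert_iff, Set.mem_image] at hx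
        obtain rfl | rfl | ⟨y, hy, rfl⟩ := hx
        · exact ⟨_, rfl⟩
        · exact ⟨_, rfl⟩
        · have hyg : y ∈ g.range := hs ▸ Subgroup.subset_closure hy
          obtain ⟨w, rfl⟩ := hyg
          exact ⟨_, hpκ' w⟩
      · rw [MonoidHom.range_eq_map, ← FreeGroup.closure_range_of, MonoidHom.map_closure,
          Subgroup.closure_le]
        rintro _ ⟨_, ⟨z | _ | _, rfl⟩, rfl⟩
        · have hz : κ (g (FreeGroup.of z)) ∈ (Subgroup.closure (s : Set (FreeGroup D))).map κ :=
            hs ▸ ⟨_, ⟨_, rfl⟩, rfl⟩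
          rw [MonoidHom.map_closure] at hz
          rw [hpκ]
          refine Subgroup.closure_mono ?_ hz
          intro x hx
          simp only [Finset.coe_insert, Finset.coe_image]
          exact Or.inr (Or.inr hx)
        · exact Subgroup.subset_closure (by simp)
        · exact Subgroup.subset_closure (by simp)
    · rw [← hcard]
      refine (Finset.card_insert_le _ _).trans (Nat.succ_le_succ ?_)
      exact (Finset.card_insert_le _ _).trans (Nat.succ_le_succ Finset.card_image_le)
  · obtain ⟨T, hcard, hT⟩ := exists_card_eq_subgroupRank (FreeGroup.fg_range_of_finite p)
    rw [← hcard]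
    let K : Bool → Subgroup (FreeGroup (D ⊕ Bool)) := fun i =>
      cond i ((FreeGroup.map Sum.inl).comp g).range ⊤
    let X := IsFreeGroup.Generators (K true)
    let j : (Monoid.CoprodI fun i => K i) →* Monoid.CoprodI fun _ : Bool => FreeGroup (D ⊕ Bool) :=
      Monoid.CoprodI.lift fun i =>
        (Monoid.CoprodI.of (M := fun _ : Bool => FreeGroup (D ⊕ Bool)) (i := i)).comp (K i).subtype
    have hj : Function.Injective j :=
      Monoid.CoprodI.map_injective (G := fun _ : Bool => FreeGroup (D ⊕ Bool)) _
        fun i => (K i).subtype_injective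
    let r : FreeGroup S →* K true := ((FreeGroup.map Sum.inl).comp g).rangeRestrict
    let q : FreeGroup (S ⊕ Bool) →* Monoid.CoprodI fun i => K i := FreeGroup.lift <| Sum.elim
      (fun s => Monoid.CoprodI.of (i := true) (r (FreeGroup.of s)))
      (fun b => Monoid.CoprodI.of (i := false)
        (⟨FreeGroup.of (Sum.inr b), Subgroup.mem_top _⟩ : K false))
    have hjq : j.comp q = θ.comp p := by
      ext (s | b)
      · simp [j, q, hpκ, hθκ, r]
        rfl
      · simp [j, q, hθp]
    have hq : ∀ w, q (FreeGroup.map Sum.inl w) = Monoid.CoprodI.of (i := true) (r w) := fun w =>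
      DFunLike.congr_fun (FreeGroup.ext_hom (f := q.comp (FreeGroup.map Sum.inl))
        (g := (Monoid.CoprodI.of (M := fun i => K i) (i := true)).comp r) (by simp [q])) w
    let β : ∀ i, K i →* Multiplicative (X ⊕ Bool →₀ ℤ) := fun i => match i with
      | true => IsFreeGroup.lift fun x => Multiplicative.ofAdd (Finsupp.single (Sum.inl x) 1)
      | false => (FreeGroup.lift (Sum.elim (fun _ => 1) fun b =>
          Multiplicative.ofAdd (Finsupp.single (Sum.inr b) 1))).comp (K false).subtype
    obtain ⟨hfin, hle⟩ := card_le_card_of_closure_eq_range p ((Monoid.CoprodI.lift β).comp q)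
      (fun x hx => by
        have : j (q x) = 1 := by
          have := DFunLike.congr_fun hjq x
          simpa [MonoidHom.mem_ker.1 hx] using this
        have : q x = 1 := hj (by rw [this, map_one])
        simp [MonoidHom.mem_ker, this])
      (by
        rintro (x | b)
        · obtain ⟨w, hw⟩ := MonoidHom.rangeRestrict_surjective _ (IsFreeGroup.of x : K true)
          refine ⟨FreeGroup.map Sum.inl w, ?_⟩
          have hw : r w = IsFreeGroup.of x := hw
          simp [hq, hw, β]
        · refine ⟨FreeGroup.of (Sum.inr b), ?_⟩
          simp [q, β])
      T hT
    have : Finite X := Finite.of_injective (Sum.inl : X → X ⊕ Bool) Sum.inl_injective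
    have := Fintype.ofFinite X
    let ρ : FreeGroup (D ⊕ Bool) →* FreeGroup D :=
      FreeGroup.lift (Sum.elim FreeGroup.of fun _ => 1)
    have hρ : ρ.comp (FreeGroup.map Sum.inl) = MonoidHom.id _ := by
      ext d
      simp [ρ]
    have hgen : Subgroup.closure ((Finset.univ.image fun x : X =>
        ρ (IsFreeGroup.of x : K true) : Finset (FreeGroup D)) : Set (FreeGroup D)) = g.range := by
      have hK : (K true).map ρ = g.range := by
        change (MonoidHom.range _).map ρ = _
        rw [MonoidHom.map_range, ← MonoidHom.comp_assoc, hρ, MonoidHom.id_comp]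
      have himage : ((Finset.univ.image fun x : X => ρ (IsFreeGroup.of x : K true) :
          Finset (FreeGroup D)) : Set (FreeGroup D)) =
          (ρ.comp (K true).subtype) '' Set.range (IsFreeGroup.of : X → K true) := by
        rw [← Set.range_comp]
        simp
        rfl
      rw [himage, ← MonoidHom.map_closure, IsFreeGroup.closure_range_of, ← hK,
        ← Subgroup.map_map, ← MonoidHom.range_eq_map, Subgroup.range_subtype]
    have hrank := (subgroupRank_le_card _ hgen).trans Finset.card_image_le
    simp at hle hrank
    omega

namespace PCP

/-- The homomorphism onto the free product of `F(Δ)` and `F(B, E)`, inside copies of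
`F(Δ ⊔ {B, E})`, that kills `#` and sends `B` to `B a⁻¹` and `E` to `b⁻¹ E`. -/
noncomputable def killHash {D : Type*} (a b : FreeGroup D) :
    FreeGroup (Del' D) →* Monoid.CoprodI fun _ : Bool => FreeGroup (D ⊕ Bool) :=
  FreeGroup.lift <| Sum.elim
    (fun d => Monoid.CoprodI.of (i := true) (FreeGroup.of (Sum.inl d)))
    ![Monoid.CoprodI.of (i := false) (FreeGroup.of (Sum.inr false)) *
        (Monoid.CoprodI.of (i := true) (FreeGroup.map Sum.inl a))⁻¹,
      (Monoid.CoprodI.of (i := true) (FreeGroup.map Sum.inl b))⁻¹ *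
        Monoid.CoprodI.of (i := false) (FreeGroup.of (Sum.inr true)),
      1]

section killHash

variable {D : Type*} (a b : FreeGroup D)

@[simp]
theorem killHash_hsh : killHash a b hsh = 1 := by
  simp [killHash, hsh]

@[simp]
theorem killHash_Bd : killHash a b Bd =
    Monoid.CoprodI.of (i := false) (FreeGroup.of (Sum.inr false)) *
      (Monoid.CoprodI.of (i := true) (FreeGroup.map Sum.inl a))⁻¹ := by
  simp [killHash, Bd]

@[simp]
theorem killHash_Ed : killHash a b Ed =
    (Monoid.CoprodI.of (i := true) (FreeGroup.map Sum.inl b))⁻¹ *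
      Monoid.CoprodI.of (i := false) (FreeGroup.of (Sum.inr true)) := by
  simp [killHash, Ed]

@[simp]
theorem killHash_incD (w : FreeGroup D) : killHash a b (incD w) =
    Monoid.CoprodI.of (i := true) (FreeGroup.map Sum.inl w) :=
  DFunLike.congr_fun (FreeGroup.ext_hom (f := (killHash a b).comp incD)
    (g := (Monoid.CoprodI.of (M := fun _ : Bool => FreeGroup (D ⊕ Bool)) (i := true)).comp
      (FreeGroup.map Sum.inl)) (by simp [killHash, incD])) w

end killHash

end PCP

open PCP in
/-- For `Σ` finite, `rk(Im(g')) = rk(Im(g)) + 2` and `rk(Im(h')) = rk(Im(h)) + 2`. -/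
theorem rank_image_eq_rank_add_two {S D : Type*} [Finite S]
    (g h : FreeGroup S →* FreeGroup D) (u₁ u₂ v₁ v₂ : FreeGroup D) :
    subgroupRank (gMap g u₁ u₂).range = subgroupRank g.range + 2 ∧
    subgroupRank (hMap h v₁ v₂).range = subgroupRank h.range + 2 := by
  constructor
  · refine subgroupRank_range_eq_add_two g _ ((MulAut.conj hsh⁻¹).toMonoidHom.comp incD)
      (killHash u₁ u₂) (fun s => ?_) (fun w => ?_) (fun c => ?_)
    · simp [gMap]
    · simp
    · cases c <;> simp [gMap]
  · refine subgroupRank_range_eq_add_two h _ ((MulAut.conj hsh).toMonoidHom.comp incD)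
      (killHash v₁ v₂) (fun s => ?_) (fun w => ?_) (fun c => ?_)
    · simp [hMap]
    · simp
    · cases c <;> simp [hMap]
end
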